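/- arXiv:1210.6946 — 2 statements merged into one kernel-verified Lean document; each statement's English description precedes it below -/
import Mathlib

section
/- Assume GRH and LI for modulus q. Let a₁,…,a_k be distinct invertible residues mod q and α₁,…,α_k real numbers, not all zero, with Σ_i α_i = 0. Define V := Σ_{χ ≠ χ₀ mod q} |α₁χ(a₁)+…+α_kχ(a_k)|² · Σ_{γ} 1/(1/4 + γ²), where the inner sum runs over all γ (with multiplicity) such that 1/2 + iγ is a zero of L(s,χ). Then there exist absolute constants c₁, c₂ > 0 such that c₁·φ(q)·(Σ_i α_i²)·log(3φ(q)/k) ≤ V ≤ c₂·φ(q)·(Σ_i α_i²)·log q. -/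
open Filter Topology MeasureTheory

noncomputable section

/-- The L-function of a Dirichlet character mod `q`, as a total function (junk value `0`
when `q = 0`). -/
def LFun (q : ℕ) (χ : DirichletCharacter ℂ q) (s : ℂ) : ℂ :=
  if h : q ≠ 0 then
    haveI : NeZero q := ⟨h⟩
    DirichletCharacter.LFunction χ s
  else 0

/-- GRH for all Dirichlet L-functions. -/
def GRH : Prop :=
  ∀ (N : ℕ) (χ : DirichletCharacter ℂ N), N ≠ 0 → χ.IsPrimitive →
    ∀ s : ℂ, 0 < s.re → s.re < 1 → LFun N χ s = 0 → s.re = 1 / 2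

/-- The set of nonnegative imaginary parts of nontrivial zeros of L-functions of primitive
Dirichlet characters mod `q`. -/
def LISet (q : ℕ) : Set ℝ :=
  {γ : ℝ | 0 ≤ γ ∧ ∃ χ : DirichletCharacter ℂ q, χ.IsPrimitive ∧
    ∃ s : ℂ, 0 < s.re ∧ s.re < 1 ∧ s.im = γ ∧ LFun q χ s = 0}

/-- The Linear Independence hypothesis for modulus `q`. -/
def LI (q : ℕ) : Prop :=
  LinearIndependent ℚ ((↑) : LISet q → ℝ)

/-- Number of primes `p ≤ x` with `p ≡ a (mod q)`. -/
def primePi (q : ℕ) (a : ZMod q) (x : ℝ) : ℕ :=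
  Nat.card {p : ℕ | p.Prime ∧ (p : ℝ) ≤ x ∧ (p : ZMod q) = a}

/-- Number of primes `p ≤ x` whose residue class mod `q` is a square in `(ZMod q)ˣ`. -/
def primePiR (q : ℕ) (x : ℝ) : ℕ :=
  Nat.card {p : ℕ | p.Prime ∧ (p : ℝ) ≤ x ∧
    ∃ u : (ZMod q)ˣ, ((u : ZMod q)) ^ 2 = (p : ZMod q)}

/-- Number of primes `p ≤ x` coprime to `q` whose residue class mod `q` is not a square
in `(ZMod q)ˣ`. -/
def primePiNR (q : ℕ) (x : ℝ) : ℕ :=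
  Nat.card {p : ℕ | p.Prime ∧ (p : ℝ) ≤ x ∧ IsUnit (p : ZMod q) ∧
    ¬ ∃ u : (ZMod q)ˣ, ((u : ZMod q)) ^ 2 = (p : ZMod q)}

/-- `ρ(q)`: the index of the subgroup of squares in `(ZMod q)ˣ`. -/
def rho (q : ℕ) : ℕ :=
  (MonoidHom.range (powMonoidHom 2 : (ZMod q)ˣ →* (ZMod q)ˣ)).index

/-- Partial logarithmic averages of a set of naturals. -/
def logSum (P : Set ℕ) (N : ℕ) : ℝ :=
  (Real.log N)⁻¹ * ∑ n ∈ Finset.range (N + 1), Set.indicator P (fun n => (n : ℝ)⁻¹) n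

/-- `P` has logarithmic density `d`. -/
def HasLogDensity (P : Set ℕ) (d : ℝ) : Prop :=
  Filter.Tendsto (logSum P) Filter.atTop (nhds d)

/-- The set of `n` for which non-residues beat residues:
`π(n;q,NR) > (ρ(q)-1)·π(n;q,R)`. -/
def raceNR (q : ℕ) : Set ℕ :=
  {n : ℕ | ((rho q : ℝ) - 1) * primePiR q n < primePiNR q n}

open Classical in
/-- The multiplicity (analytic order) of `s` as a zero of `f`. -/
def zeroMult (f : ℂ → ℂ) (s : ℂ) : ℕ :=
  if h : ∃ n : ℕ, ∃ g : ℂ → ℂ, AnalyticAt ℂ g s ∧ g s ≠ 0 ∧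
      (∀ᶠ z in nhds s, f z = (z - s) ^ n * g z)
  then h.choose else 0

/-- The product of the L-functions of the nontrivial real (quadratic) characters mod `q`. -/
def Zfun (q : ℕ) (s : ℂ) : ℂ :=
  ∏ᶠ χ ∈ {χ : DirichletCharacter ℂ q | χ ^ 2 = 1 ∧ χ ≠ 1}, LFun q χ s

/-- `∑_γ m(γ)/(1/4+γ²)`, the sum over the zeros `1/2+iγ` of `L(s,χ)`, with multiplicity. -/
def zeroSumInv (q : ℕ) (χ : DirichletCharacter ℂ q) : ℝ :=
  ∑' γ : ℝ, (zeroMult (LFun q χ) (1 / 2 + γ * Complex.I) : ℝ) / (1 / 4 + γ ^ 2)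

/-- `ω(q)`: number of distinct prime factors. -/
def omega (q : ℕ) : ℕ := q.primeFactors.card

/-- The radical `q' = ∏_{p ∣ q} p`. -/
def radical (q : ℕ) : ℕ := ∏ p ∈ q.primeFactors, p

/-- The race set for a general linear combination of prime counting functions. -/
def raceSet (q : ℕ) {k : ℕ} (a : Fin k → (ZMod q)ˣ) (α : Fin k → ℝ) : Set ℕ :=
  {n : ℕ | 0 < ∑ i, α i * primePi q ((a i : ZMod q)) n}

/-- `E_q(x) = (π(x;q,NR) − (ρ(q)−1)π(x;q,R))·log x/√x`. -/
def Efun (q : ℕ) (x : ℝ) : ℝ :=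
  ((primePiNR q x : ℝ) - ((rho q : ℝ) - 1) * primePiR q x) * Real.log x / Real.sqrt x

/-- `μ` is the limiting logarithmic distribution of `E_q(e^y)`. -/
def IsLimitingDistribution (q : ℕ) (μ : Measure ℝ) : Prop :=
  IsProbabilityMeasure μ ∧
    ∀ f : ℝ → ℝ, (∃ C : ℝ, ∀ x, |f x| ≤ C) → (∃ K : NNReal, LipschitzWith K f) →
      Tendsto (fun Y : ℝ => (1 / Y) * ∫ y in (2:ℝ)..Y, f (Efun q (Real.exp y)))
        atTop (nhds (∫ t, f t ∂μ))

/-- `S(q)`: sum over the nontrivial real characters mod `q` of `∑_γ m(γ)/(1/4+γ²)`. -/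
def Sq (q : ℕ) : ℝ :=
  ∑ᶠ χ ∈ {χ : DirichletCharacter ℂ q | χ ^ 2 = 1 ∧ χ ≠ 1}, zeroSumInv q χ

/-- The standard normal distribution function `Φ`. -/
def normalCDF (x : ℝ) : ℝ :=
  (Real.sqrt (2 * Real.pi))⁻¹ * ∫ t in Set.Iic x, Real.exp (-t ^ 2 / 2)

end

open scoped Classical
open Asymptotics

/-- The variance of the limiting random variable attached to a general race. -/
noncomputable def Vgen (q k : ℕ) (a : Fin k → (ZMod q)ˣ) (α : Fin k → ℝ) : ℝ :=
  ∑ᶠ χ ∈ {χ : DirichletCharacter ℂ q | χ ≠ 1},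
    ‖∑ i, (α i : ℂ) * χ ((a i : ZMod q))‖ ^ 2 * zeroSumInv q χ

/-- An entire function that is not identically zero has finite order of vanishing everywhere. -/
lemma Differentiable.analyticOrderAt_ne_top {f : ℂ → ℂ} (hf : Differentiable ℂ f) {w : ℂ}
    (hw : f w ≠ 0) (z : ℂ) : analyticOrderAt f z ≠ ⊤ := by
  have h := (hf.analyticAt w).analyticOrderAt_eq_zero.2 hw
  exact AnalyticOnNhd.analyticOrderAt_ne_top_of_isPreconnected (U := Set.univ)
    (fun z _ => hf.analyticAt z) isPreconnected_univ (Set.mem_univ w) (Set.mem_univ z)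
    (by simp [h])

/-- A zero of an entire function can be divided out globally. -/
lemma Differentiable.exists_eq_pow_mul {f : ℂ → ℂ} (hf : Differentiable ℂ f) {w : ℂ}
    (hw : f w ≠ 0) (ρ : ℂ) :
    ∃ g : ℂ → ℂ, Differentiable ℂ g ∧ g ρ ≠ 0 ∧
      ∀ z, f z = (z - ρ) ^ analyticOrderNatAt f ρ * g z := by
  obtain ⟨g₀, hg₀, hne, hev⟩ :=
    ((hf.analyticAt ρ).analyticOrderAt_ne_top).1 (hf.analyticOrderAt_ne_top hw ρ)
  set n := analyticOrderNatAt f ρ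
  set g : ℂ → ℂ := fun z => if z = ρ then g₀ ρ else f z / (z - ρ) ^ n with hg
  have hgρ : g =ᶠ[𝓝 ρ] g₀ := by
    filter_upwards [hev] with z hz
    by_cases h : z = ρ
    · simp [hg, h]
    · have : (z - ρ) ^ n ≠ 0 := pow_ne_zero _ (sub_ne_zero.2 h)
      simp only [hg, h, if_false, hz, smul_eq_mul]
      field_simp
  refine ⟨g, fun z => ?_, by simpa [hg] using hne, fun z => ?_⟩
  · by_cases h : z = ρ
    · subst h
      exact hg₀.differentiableAt.congr_of_eventuallyEq hgρ
    · have hd : DifferentiableAt ℂ (fun z => f z / (z - ρ) ^ n) z :=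
        (hf z).div (by fun_prop) (pow_ne_zero _ (sub_ne_zero.2 h))
      refine hd.congr_of_eventuallyEq ?_
      filter_upwards [isOpen_ne.mem_nhds h] with y hy
      simp only [hg, if_neg (show y ≠ ρ from hy)]
  · by_cases h : z = ρ
    · subst h
      simpa [hg] using hev.self_of_nhds
    · have : (z - ρ) ^ n ≠ 0 := pow_ne_zero _ (sub_ne_zero.2 h)
      simp only [hg, h, if_false]
      field_simp

/-- Finitely many nonzero points can be divided out of an entire function, with their
multiplicities, by the factors `1 - z / ρ`. -/
lemma Differentiable.exists_eq_prod_mul {f : ℂ → ℂ} (hf : Differentiable ℂ f)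
    (h0 : f 0 ≠ 0) (S : Finset ℂ) (hS : ∀ ρ ∈ S, ρ ≠ 0) :
    ∃ g : ℂ → ℂ, Differentiable ℂ g ∧ (∀ ρ ∈ S, g ρ ≠ 0) ∧
      ∀ z, f z = (∏ ρ ∈ S, (1 - z / ρ) ^ analyticOrderNatAt f ρ) * g z := by
  induction S using Finset.induction_on with
  | empty => exact ⟨f, hf, by simp, by simp⟩
  | insert a S ha ih =>
    obtain ⟨g, hg, hgS, hfg⟩ := ih fun ρ hρ => hS ρ (Finset.mem_insert_of_mem hρ)
    have ha0 : a ≠ 0 := hS a (Finset.mem_insert_self _ _)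
    have hg0 : g 0 ≠ 0 := by
      intro h
      apply h0
      rw [hfg, h, mul_zero]
    set P : ℂ → ℂ := fun z => ∏ ρ ∈ S, (1 - z / ρ) ^ analyticOrderNatAt f ρ with hP
    have hPd : Differentiable ℂ P := by
      intro z
      refine DifferentiableAt.fun_finsetProd fun ρ _ => ?_
      fun_prop
    have hPa : P a ≠ 0 := by
      refine Finset.prod_ne_zero_iff.2 fun ρ hρ => pow_ne_zero _ ?_
      have hρ0 : ρ ≠ 0 := hS ρ (Finset.mem_insert_of_mem hρ)
      intro h
      have : a = ρ := by
        field_simp at h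
        linear_combination -h
      exact ha (this ▸ hρ)
    have hord : analyticOrderNatAt f a = analyticOrderNatAt g a := by
      have : f = P * g := funext hfg
      rw [this, analyticOrderNatAt_mul (hPd.analyticAt a) (hg.analyticAt a)
        (by simp [(hPd.analyticAt a).analyticOrderAt_eq_zero.2 hPa])
        (hg.analyticOrderAt_ne_top hg0 a)]
      simp [analyticOrderNatAt, (hPd.analyticAt a).analyticOrderAt_eq_zero.2 hPa]
    obtain ⟨k, hk, hka, hgk⟩ := hg.exists_eq_pow_mul hg0 a
    refine ⟨fun z => (-a) ^ analyticOrderNatAt g a * k z, hk.const_mul _, ?_, fun z => ?_⟩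
    · intro ρ hρ
      have hna : (-a) ^ analyticOrderNatAt g a ≠ 0 := pow_ne_zero _ (neg_ne_zero.2 ha0)
      refine mul_ne_zero hna ?_
      rcases Finset.mem_insert.1 hρ with rfl | h
      · exact hka
      · intro hk0
        apply hgS ρ h
        rw [hgk, hk0, mul_zero]
    · rw [Finset.prod_insert ha, hfg z, hgk z, hord]
      have : z - a = (1 - z / a) * (-a) := by field_simp; ring
      rw [this, mul_pow]
      ring

/-- A nonvanishing holomorphic function on a disc has a holomorphic logarithm. -/
lemma exists_log_on_ball {g : ℂ → ℂ} {r : ℝ} (hr : 0 < r) (hg : Differentiable ℂ g)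
    (hne : ∀ z ∈ Metric.ball (0 : ℂ) r, g z ≠ 0) :
    ∃ l : ℂ → ℂ, DifferentiableOn ℂ l (Metric.ball 0 r) ∧ l 0 = 0 ∧
      ∀ z ∈ Metric.ball (0 : ℂ) r, g z = g 0 * Complex.exp (l z) := by
  have hd : DifferentiableOn ℂ (fun z => deriv g z / g z) (Metric.ball 0 r) := by
    refine DifferentiableOn.div ?_ hg.differentiableOn hne
    exact (hg.differentiableOn (s := Set.univ)).deriv isOpen_univ |>.mono (Set.subset_univ _)
  obtain ⟨L, hL⟩ := hd.isExactOn_ball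
  refine ⟨fun z => L z - L 0, fun z hz => ?_, by simp, fun z hz => ?_⟩
  · exact ((hL z hz).differentiableAt.sub_const _).differentiableWithinAt
  · have h0 : (0 : ℂ) ∈ Metric.ball (0 : ℂ) r := Metric.mem_ball_self hr
    have hc : ∀ y ∈ Metric.ball (0 : ℂ) r,
        HasDerivAt (fun z => g z * Complex.exp (-(L z - L 0))) 0 y := by
      intro y hy
      refine ((hg y).hasDerivAt.mul ((((hL y hy).sub_const (L 0)).neg).cexp)).congr_deriv ?_
      have e : g y * (deriv g y / g y) = deriv g y := by
        have := hne y hy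
        field_simp
      linear_combination -Complex.exp (-(L y - L 0)) * e
    have hconst := (convex_ball (0 : ℂ) r).is_const_of_fderivWithin_eq_zero (𝕜 := ℂ)
      (f := fun z => g z * Complex.exp (-(L z - L 0)))
      (fun y hy => (hc y hy).differentiableAt.differentiableWithinAt)
      (fun y hy => by
        rw [fderivWithin_of_isOpen Metric.isOpen_ball hy]
        ext
        simpa using (hc y hy).deriv) hz h0
    simp only [sub_self, neg_zero, Complex.exp_zero, mul_one] at hconst
    rw [← hconst, mul_assoc, ← Complex.exp_add]
    simp

/-- If `g` has no zeros in the disc of radius `r` and is not too large there, then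
`log |g x g (-x)|` varies little. -/
lemma abs_log_norm_mul_neg_le {g : ℂ → ℂ} {r A : ℝ} (hr : 0 < r) (hA : 0 < A)
    (hg : Differentiable ℂ g) (hne : ∀ z ∈ Metric.ball (0 : ℂ) r, g z ≠ 0)
    (hb : ∀ z ∈ Metric.ball (0 : ℂ) r, ‖g z‖ ≤ ‖g 0‖ * Real.exp A) {x : ℝ} (hx : 2 * |x| < r) :
    |Real.log ‖g x * g (-x)‖ - 2 * Real.log ‖g 0‖| ≤ 16 * A * (x / r) ^ 2 := by
  obtain ⟨l, hl, hl0, hgl⟩ := exists_log_on_ball hr hg hne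
  have h0 : (0 : ℂ) ∈ Metric.ball (0 : ℂ) r := Metric.mem_ball_self hr
  have hg0 : 0 < ‖g 0‖ := norm_pos_iff.2 (hne 0 h0)
  have hre : Set.MapsTo l (Metric.ball 0 r) {z | z.re ≤ A} := by
    intro z hz
    have := hb z hz
    rw [hgl z hz, norm_mul, Complex.norm_exp] at this
    exact Real.exp_le_exp.1 (le_of_mul_le_mul_left this hg0)
  have hr2 : Metric.ball (0 : ℂ) (r / 2) ⊆ Metric.ball 0 r :=
    Metric.ball_subset_ball (by linarith)
  have hneg : ∀ {s : ℝ} {z : ℂ}, z ∈ Metric.ball (0 : ℂ) s → -z ∈ Metric.ball (0 : ℂ) s := by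
    intro s z hz
    simpa using hz
  have hlb : ∀ z ∈ Metric.ball (0 : ℂ) (r / 2), ‖l z‖ ≤ 2 * A := by
    intro z hz
    have hz' : ‖z‖ < r / 2 := by simpa using hz
    refine (Complex.borelCaratheodory_zero hA hl hre hr (hr2 hz) hl0).trans ?_
    rw [div_le_iff₀ (by linarith)]
    nlinarith
  set h : ℂ → ℂ := fun z => l z + l (-z) with hh
  have hlneg : DifferentiableOn ℂ (fun z => l (-z)) (Metric.ball 0 (r / 2)) :=
    (hl.mono hr2).comp (by fun_prop) fun z hz => hneg hz
  have hhd : DifferentiableOn ℂ h (Metric.ball 0 (r / 2)) := (hl.mono hr2).add hlneg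
  have hh0 : h 0 = 0 := by simp [hh, hl0]
  have hmaps : Set.MapsTo h (Metric.ball 0 (r / 2)) (Metric.closedBall (h 0) (4 * A)) := by
    intro z hz
    rw [hh0, mem_closedBall_zero_iff]
    refine (norm_add_le _ _).trans ?_
    linarith [hlb z hz, hlb (-z) (hneg hz)]
  have hderiv : HasDerivAt h 0 0 := by
    have h1 : HasDerivAt l (deriv l 0) 0 :=
      (hl.differentiableAt (Metric.ball_mem_nhds 0 hr)).hasDerivAt
    have h2 : HasDerivAt (fun z => l (-z)) (-deriv l 0) 0 := by
      have := HasDerivAt.scomp_of_eq (0 : ℂ) (y := 0) (h := fun z => -z) h1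
        (hasDerivAt_neg (0 : ℂ)) (by simp)
      simpa [Function.comp_def] using this
    have := h1.add h2
    rwa [add_neg_cancel] at this
  have hlit : (h · - h 0) =o[𝓝 0] (fun w : ℂ => ‖w - 0‖ ^ 1) := by
    have := hderiv.isLittleO
    simp only [smul_zero, sub_zero, pow_one] at this ⊢
    exact this.norm_right
  have hxb : (x : ℂ) ∈ Metric.ball (0 : ℂ) (r / 2) := by
    simp only [mem_ball_zero_iff, Complex.norm_real, Real.norm_eq_abs]
    linarith
  have key := Complex.dist_le_mul_div_pow_of_mapsTo_ball_of_isLittleO hhd hmaps hlit hxb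
  rw [hh0, dist_zero_right, dist_zero_right, Complex.norm_real, Real.norm_eq_abs] at key
  have hval : Real.log ‖g x * g (-x)‖ - 2 * Real.log ‖g 0‖ = (h x).re := by
    rw [hgl _ (hr2 hxb), hgl _ (hr2 (hneg hxb)), norm_mul, norm_mul, norm_mul, Complex.norm_exp,
      Complex.norm_exp, Real.log_mul (by positivity) (by positivity),
      Real.log_mul hg0.ne' (by positivity), Real.log_mul hg0.ne' (by positivity), Real.log_exp,
      Real.log_exp]
    simp only [hh, Complex.add_re]
    ring
  rw [hval]
  refine (Complex.abs_re_le_norm _).trans (key.trans (le_of_eq ?_))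
  simp only [div_pow, Nat.reduceAdd, sq_abs]
  field_simp
  ring

/-- The zeros of a nonzero entire function in a bounded piece of the imaginary axis. -/
lemma finite_imaginary_zeros {f : ℂ → ℂ} (hf : Differentiable ℂ f) {w : ℂ} (hw : f w ≠ 0)
    (r : ℝ) : {γ : ℝ | |γ| ≤ r ∧ f (γ * Complex.I) = 0}.Finite := by
  have h : f ⁻¹' {0}ᶜ ∈ Filter.codiscrete ℂ :=
    AnalyticOnNhd.preimage_zero_mem_codiscrete (fun z _ => hf.analyticAt z) hw
  obtain ⟨h1, h2⟩ := mem_codiscrete'.mp h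
  have hcl : IsClosed (f ⁻¹' {0}) := isOpen_compl_iff.1 h1
  have hfin : (Metric.closedBall (0 : ℂ) r ∩ f ⁻¹' {0}).Finite := by
    refine ((isCompact_closedBall 0 r).inter_right hcl).finite ?_
    refine IsDiscrete.mono ?_ Set.inter_subset_right
    simpa using h2
  refine (hfin.preimage (f := fun γ : ℝ => (γ : ℂ) * Complex.I) ?_).subset ?_
  · intro a _ b _ hab
    simpa using hab
  · intro γ hγ
    simpa using hγ

/-- The contribution of the zeros `iγ` of bounded height to `log |f y f (-y) / (f x f (-x))|`. -/
lemma abs_sum_zeros_sub_le {f : ℂ → ℂ} (hf : Differentiable ℂ f) (h0 : f 0 ≠ 0)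
    (hz : ∀ z, f z = 0 → z.re = 0) {C : ℝ} (hC : 0 ≤ C)
    (hgr : ∀ z, 1 ≤ ‖z‖ → ‖f z‖ ≤ Real.exp (C * ‖z‖ ^ (3 / 2 : ℝ)))
    {x y r : ℝ} (hx : 0 < x) (hxy : x < y) (hr1 : 1 ≤ r) (hr : 2 * y < r)
    (T : Finset ℝ) (hT : ∀ γ : ℝ, γ ∈ T ↔ |γ| ≤ r ∧ f (γ * Complex.I) = 0) :
    |∑ γ ∈ T, (analyticOrderNatAt f (γ * Complex.I) : ℝ) *
          Real.log ((y ^ 2 + γ ^ 2) / (x ^ 2 + γ ^ 2)) -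
        (Real.log ‖f y * f (-y)‖ - Real.log ‖f x * f (-x)‖)| ≤
      32 * (C * (2 * r) ^ (3 / 2 : ℝ) + |Real.log ‖f 0‖| + 1) * (y / r) ^ 2 := by
  have hinj : Set.InjOn (fun γ : ℝ => (γ : ℂ) * Complex.I) T := by
    intro a _ b _ hab
    simpa using hab
  have hT0 : ∀ γ ∈ T, γ ≠ 0 := by
    rintro γ hγ rfl
    exact h0 (by simpa using ((hT 0).1 hγ).2)
  set S : Finset ℂ := T.image fun γ : ℝ => (γ : ℂ) * Complex.I with hS
  have hS0 : ∀ ρ ∈ S, ρ ≠ 0 := by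
    intro ρ hρ
    obtain ⟨γ, hγ, rfl⟩ := Finset.mem_image.1 hρ
    simpa using hT0 γ hγ
  have hSr : ∀ ρ ∈ S, ‖ρ‖ ≤ r := by
    intro ρ hρ
    obtain ⟨γ, hγ, rfl⟩ := Finset.mem_image.1 hρ
    simpa using ((hT γ).1 hγ).1
  obtain ⟨g, hg, hgS, hfg⟩ := hf.exists_eq_prod_mul h0 S hS0
  have hg0 : g 0 = f 0 := by simp [hfg 0]
  have hr0 : 0 < r := by linarith
  have hgne : ∀ z ∈ Metric.ball (0 : ℂ) r, g z ≠ 0 := by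
    intro z hz' hgz
    have hfz : f z = 0 := by rw [hfg, hgz, mul_zero]
    have hzI : z = (z.im : ℂ) * Complex.I := by
      apply Complex.ext <;> simp [hz z hfz]
    refine hgS z ?_ hgz
    refine Finset.mem_image.2 ⟨z.im, (hT _).2 ⟨?_, by rwa [← hzI]⟩, hzI.symm⟩
    have : ‖z‖ < r := by simpa using hz'
    exact (Complex.abs_im_le_norm z).trans this.le
  set M := C * (2 * r) ^ (3 / 2 : ℝ) with hM
  have hM0 : 0 ≤ M := by positivity
  have hgb : ∀ z ∈ Metric.ball (0 : ℂ) r, ‖g z‖ ≤ Real.exp M := by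
    intro z hz'
    refine Complex.norm_le_of_forall_mem_frontier_norm_le (U := Metric.ball 0 (2 * r))
      Metric.isBounded_ball hg.diffContOnCl (fun w hw => ?_)
      (subset_closure (Metric.ball_subset_ball (by linarith) hz'))
    rw [frontier_ball _ (by positivity), mem_sphere_zero_iff_norm] at hw
    have h1 : ‖f w‖ ≤ Real.exp M := by
      have := hgr w (by linarith)
      rwa [hw] at this
    rw [hfg, norm_mul, norm_prod] at h1
    refine le_trans (le_mul_of_one_le_left (norm_nonneg _) ?_) h1
    refine Finset.prod_induction _ (fun t => (1 : ℝ) ≤ t) (fun a b => one_le_mul_of_one_le_of_one_le)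
      le_rfl fun ρ hρ => ?_
    rw [norm_pow]
    refine one_le_pow₀ ?_
    have hρ0 : 0 < ‖ρ‖ := norm_pos_iff.2 (hS0 ρ hρ)
    have h2 : 2 ≤ ‖w / ρ‖ := by
      rw [norm_div, hw, le_div_iff₀ hρ0]
      linarith [hSr ρ hρ]
    have := norm_sub_norm_le (w / ρ) 1
    rw [norm_one, norm_sub_rev] at this
    linarith
  set A := M + |Real.log ‖f 0‖| + 1 with hA
  have hApos : 0 < A := by positivity
  have hgb' : ∀ z ∈ Metric.ball (0 : ℂ) r, ‖g z‖ ≤ ‖g 0‖ * Real.exp A := by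
    intro z hz'
    refine (hgb z hz').trans ?_
    have hf0 : 0 < ‖f 0‖ := norm_pos_iff.2 h0
    rw [hg0]
    nth_rewrite 1 [← Real.exp_log hf0]
    rw [← Real.exp_add, Real.exp_le_exp]
    linarith [neg_abs_le (Real.log ‖f 0‖)]
  have key : ∀ t : ℝ, 0 < t → Real.log ‖f t * f (-t)‖ =
      ∑ γ ∈ T, (analyticOrderNatAt f (γ * Complex.I) : ℝ) * Real.log (1 + t ^ 2 / γ ^ 2) +
        Real.log ‖g t * g (-t)‖ := by
    intro t ht
    have hft : f t ≠ 0 := fun h => ht.ne' (by simpa using hz _ h)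
    have hft' : f (-t) ≠ 0 := fun h => ht.ne' (by simpa using hz _ h)
    have hgt : g t ≠ 0 := fun h => hft (by rw [hfg, h, mul_zero])
    have hgt' : g (-t) ≠ 0 := fun h => hft' (by rw [hfg, h, mul_zero])
    have hprod : f t * f (-t) = (∏ γ ∈ T, ((1 + t ^ 2 / γ ^ 2 : ℝ) : ℂ) ^
        analyticOrderNatAt f (γ * Complex.I)) * (g t * g (-t)) := by
      rw [hfg t, hfg (-t), hS, Finset.prod_image hinj, Finset.prod_image hinj]
      rw [mul_mul_mul_comm, ← Finset.prod_mul_distrib]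
      congr 1
      refine Finset.prod_congr rfl fun γ hγ => ?_
      rw [← mul_pow]
      congr 1
      have : (γ : ℂ) ≠ 0 := by exact_mod_cast hT0 γ hγ
      push_cast
      field_simp
      ring_nf
      simp only [Complex.I_sq]
      ring
    have hpos : ∀ γ : ℝ, 0 < 1 + t ^ 2 / γ ^ 2 := fun γ => by positivity
    rw [hprod, norm_mul, norm_prod, Real.log_mul, Real.log_prod]
    · congr 1
      refine Finset.sum_congr rfl fun γ hγ => ?_
      rw [norm_pow, Real.log_pow, Complex.norm_real, Real.norm_of_nonneg (hpos γ).le]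
    · intro γ _
      exact norm_ne_zero_iff.2 (pow_ne_zero _ (by exact_mod_cast (hpos γ).ne'))
    · refine Finset.prod_ne_zero_iff.2 fun γ _ => norm_ne_zero_iff.2 (pow_ne_zero _ ?_)
      exact_mod_cast (hpos γ).ne'
    · exact norm_ne_zero_iff.2 (mul_ne_zero hgt hgt')
  have hlog : ∀ γ ∈ T, Real.log ((y ^ 2 + γ ^ 2) / (x ^ 2 + γ ^ 2)) =
      Real.log (1 + y ^ 2 / γ ^ 2) - Real.log (1 + x ^ 2 / γ ^ 2) := by
    intro γ hγ
    have := hT0 γ hγ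
    rw [← Real.log_div (by positivity) (by positivity)]
    congr 1
    field_simp
    ring
  have hy : 0 < y := hx.trans hxy
  have e1 := abs_log_norm_mul_neg_le hr0 hApos hg hgne hgb' (x := x)
    (by rw [abs_of_pos hx]; linarith)
  have e2 := abs_log_norm_mul_neg_le hr0 hApos hg hgne hgb' (x := y)
    (by rw [abs_of_pos hy]; linarith)
  have e3 : 16 * A * (x / r) ^ 2 ≤ 16 * A * (y / r) ^ 2 := by gcongr
  rw [Finset.sum_congr rfl fun γ hγ => by rw [hlog γ hγ, mul_sub], Finset.sum_sub_distrib,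
    key x hx, key y hy]
  rw [abs_le] at e1 e2 ⊢
  constructor <;> linarith [e1.1, e1.2, e2.1, e2.2]

/-- The logarithm of `(y² + γ²) / (x² + γ²)` summed over the zeros `iγ` of an entire function of
order less than two, all of whose zeros are purely imaginary and different from `0`. -/
lemma hasSum_zeros_of_ne_zero {f : ℂ → ℂ} (hf : Differentiable ℂ f) (h0 : f 0 ≠ 0)
    (hz : ∀ z, f z = 0 → z.re = 0) {C : ℝ}
    (hgr : ∀ z, 1 ≤ ‖z‖ → ‖f z‖ ≤ Real.exp (C * ‖z‖ ^ (3 / 2 : ℝ)))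
    {x y : ℝ} (hx : 0 < x) (hxy : x < y) :
    HasSum (fun γ : ℝ => (analyticOrderNatAt f (γ * Complex.I) : ℝ) *
        Real.log ((y ^ 2 + γ ^ 2) / (x ^ 2 + γ ^ 2)))
      (Real.log ‖f y * f (-y)‖ - Real.log ‖f x * f (-x)‖) := by
  wlog hC : 0 ≤ C generalizing C
  · refine this (C := 0) (fun z h1 => (hgr z h1).trans (Real.exp_le_exp.2 ?_)) le_rfl
    rw [zero_mul]
    exact mul_nonpos_of_nonpos_of_nonneg (not_le.1 hC).le (by positivity)
  set w : ℝ → ℝ := fun γ => (analyticOrderNatAt f (γ * Complex.I) : ℝ) *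
        Real.log ((y ^ 2 + γ ^ 2) / (x ^ 2 + γ ^ 2)) with hw
  set D := Real.log ‖f y * f (-y)‖ - Real.log ‖f x * f (-x)‖ with hD
  have hw0 : ∀ γ, 0 ≤ w γ := by
    intro γ
    refine mul_nonneg (Nat.cast_nonneg _) (Real.log_nonneg ?_)
    rw [one_le_div (by positivity)]
    gcongr
  set T : ℝ → Finset ℝ := fun r => (finite_imaginary_zeros hf h0 r).toFinset with hT
  have hTmem : ∀ r γ, γ ∈ T r ↔ |γ| ≤ r ∧ f (γ * Complex.I) = 0 := by
    intro r γ
    simp [hT]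
  have herr : Tendsto (fun r : ℝ => 32 * (C * (2 * r) ^ (3 / 2 : ℝ) + |Real.log ‖f 0‖| + 1) *
      (y / r) ^ 2) atTop (𝓝 0) := by
    have h1 : Tendsto (fun r : ℝ => 32 * C * 2 ^ (3 / 2 : ℝ) * y ^ 2 * r ^ (-(1 / 2) : ℝ) +
        32 * (|Real.log ‖f 0‖| + 1) * y ^ 2 * r ^ (-2 : ℝ)) atTop (𝓝 0) := by
      simpa using ((tendsto_rpow_neg_atTop (show (0 : ℝ) < 1 / 2 by norm_num)).const_mul
        (32 * C * 2 ^ (3 / 2 : ℝ) * y ^ 2)).add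
        ((tendsto_rpow_neg_atTop (show (0 : ℝ) < 2 by norm_num)).const_mul
        (32 * (|Real.log ‖f 0‖| + 1) * y ^ 2))
    refine h1.congr' ?_
    filter_upwards [eventually_gt_atTop 0] with r hr
    rw [Real.mul_rpow (by norm_num) hr.le, show (-(1 / 2) : ℝ) = 3 / 2 + -2 by norm_num,
      Real.rpow_add hr, Real.rpow_neg hr.le, Real.rpow_two]
    field_simp
    ring
  have happ : Tendsto (fun r => ∑ γ ∈ T r, w γ) atTop (𝓝 D) := by
    rw [tendsto_iff_norm_sub_tendsto_zero]
    refine squeeze_zero' (Eventually.of_forall fun _ => norm_nonneg _) ?_ herr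
    filter_upwards [eventually_ge_atTop 1, eventually_gt_atTop (2 * y)] with r h1 h2
    exact abs_sum_zeros_sub_le hf h0 hz hC hgr hx hxy h1 h2 (T r) (hTmem r)
  refine hasSum_of_isLUB_of_nonneg _ hw0 ⟨?_, ?_⟩
  · rintro _ ⟨U, rfl⟩
    refine ge_of_tendsto happ ?_
    obtain ⟨B, hB⟩ := (U.image fun γ => |γ|).bddAbove
    filter_upwards [eventually_ge_atTop B] with r hr
    rw [← Finset.sum_filter_ne_zero]
    refine Finset.sum_le_sum_of_subset_of_nonneg (fun γ hγ => ?_) fun γ _ _ => hw0 γ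
    obtain ⟨hγ, hne⟩ := Finset.mem_filter.1 hγ
    refine (hTmem r γ).2 ⟨(hB (by simpa using ⟨γ, hγ, rfl⟩)).trans hr, ?_⟩
    refine apply_eq_zero_of_analyticOrderNatAt_ne_zero fun h => hne ?_
    simp [hw, h]
  · intro b hb
    exact le_of_tendsto' happ fun r => hb ⟨T r, rfl⟩

/-- The logarithm of `(y² + γ²) / (x² + γ²)` summed over the zeros `iγ` of an entire function of
order less than two, all of whose zeros are purely imaginary. -/
lemma hasSum_zeros {f : ℂ → ℂ} (hf : Differentiable ℂ f)
    (hz : ∀ z, f z = 0 → z.re = 0) {C : ℝ}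
    (hgr : ∀ z, 1 ≤ ‖z‖ → ‖f z‖ ≤ Real.exp (C * ‖z‖ ^ (3 / 2 : ℝ)))
    {x y : ℝ} (hx : 0 < x) (hxy : x < y) :
    HasSum (fun γ : ℝ => (analyticOrderNatAt f (γ * Complex.I) : ℝ) *
        Real.log ((y ^ 2 + γ ^ 2) / (x ^ 2 + γ ^ 2)))
      (Real.log ‖f y * f (-y)‖ - Real.log ‖f x * f (-x)‖) := by
  have hy : 0 < y := hx.trans hxy
  have hf1 : f 1 ≠ 0 := fun h => by simpa using hz _ h
  obtain ⟨e, he, he0, hfe⟩ := hf.exists_eq_pow_mul hf1 0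
  set n := analyticOrderNatAt f 0 with hn
  simp only [sub_zero] at hfe
  have hez : ∀ z, e z = 0 → z.re = 0 := fun z h => hz z (by rw [hfe, h, mul_zero])
  have hegr : ∀ z, 1 ≤ ‖z‖ → ‖e z‖ ≤ Real.exp (C * ‖z‖ ^ (3 / 2 : ℝ)) := by
    intro z h1
    refine le_trans ?_ (hgr z h1)
    rw [hfe, norm_mul, norm_pow]
    exact le_mul_of_one_le_left (norm_nonneg _) (one_le_pow₀ h1)
  have hord : ∀ γ : ℝ, γ ≠ 0 →
      analyticOrderNatAt f (γ * Complex.I) = analyticOrderNatAt e (γ * Complex.I) := by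
    intro γ hγ
    have hpd : Differentiable ℂ fun z : ℂ => z ^ n := by fun_prop
    have hp := (hpd.analyticAt (γ * Complex.I)).analyticOrderAt_eq_zero.2
      (pow_ne_zero n (by simpa using hγ))
    have : f = (fun z : ℂ => z ^ n) * e := funext hfe
    rw [this, analyticOrderNatAt_mul (hpd.analyticAt _) (he.analyticAt _) (by simp [hp])
      (he.analyticOrderAt_ne_top he0 _)]
    simp [analyticOrderNatAt, hp]
  have hord0 : analyticOrderNatAt e 0 = 0 := by
    simp [analyticOrderNatAt, (he.analyticAt 0).analyticOrderAt_eq_zero.2 he0]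
  have h1 := hasSum_zeros_of_ne_zero he he0 hez hegr hx hxy
  have h2 := h1.add (hasSum_ite_eq (0 : ℝ) ((n : ℝ) * Real.log (y ^ 2 / x ^ 2)))
  convert! h2 using 1
  · funext γ
    by_cases hγ : γ = 0
    · subst hγ
      simp [hord0, hn]
    · simp [hord γ hγ, hγ]
  · have hval : ∀ t : ℝ, 0 < t →
        Real.log ‖f t * f (-t)‖ = n * Real.log (t ^ 2) + Real.log ‖e t * e (-t)‖ := by
      intro t ht
      have h3 : e t ≠ 0 := fun h => ht.ne' (by simpa using hez _ h)
      have h4 : e (-t) ≠ 0 := fun h => ht.ne' (by simpa using hez _ h)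
      have h5 : ‖f t * f (-t)‖ = (t ^ 2) ^ n * ‖e t * e (-t)‖ := by
        rw [hfe t, hfe (-t)]
        simp only [norm_mul, norm_pow, norm_neg, Complex.norm_real, Real.norm_of_nonneg ht.le]
        ring
      rw [h5, Real.log_mul (by positivity) (norm_ne_zero_iff.2 (mul_ne_zero h3 h4)), Real.log_pow]
    rw [hval x hx, hval y hy, Real.log_div (by positivity) (by positivity)]
    ring

/-- Partial sums of a nonprincipal character are bounded by the modulus. -/
lemma DirichletCharacter.norm_sum_range_le {N : ℕ} [NeZero N] {χ : DirichletCharacter ℂ N}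
    (hχ : χ ≠ 1) (n : ℕ) : ‖∑ k ∈ Finset.range n, χ (k : ZMod N)‖ ≤ N := by
  have hfull : ∑ k ∈ Finset.range N, χ (k : ZMod N) = 0 := by
    rw [← χ.sum_eq_zero_of_ne_one hχ]
    refine Finset.sum_bij (fun k _ => (k : ZMod N)) (by simp) ?_ ?_ (by simp)
    · intro a ha b hb hab
      rw [ZMod.natCast_eq_natCast_iff'] at hab
      rwa [Nat.mod_eq_of_lt (Finset.mem_range.1 ha), Nat.mod_eq_of_lt (Finset.mem_range.1 hb)] at hab
    · intro b _
      exact ⟨b.val, Finset.mem_range.2 b.val_lt, by simp⟩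
  induction n using Nat.strong_induction_on with
  | _ n ih =>
    rcases lt_or_ge n N with h | h
    · refine (norm_sum_le_of_le (Finset.range n) (f := fun k : ℕ => χ (k : ZMod N)) (n := fun _ => 1)
        fun k _ => χ.norm_le_one _).trans ?_
      simpa using h.le
    · obtain ⟨m, rfl⟩ := Nat.exists_eq_add_of_le h
      have := ih m (by have := NeZero.pos N; omega)
      rw [Finset.sum_range_add, hfull]
      simpa using this

lemma DirichletCharacter.norm_sum_Icc_le {N : ℕ} [NeZero N] {χ : DirichletCharacter ℂ N}
    (hχ : χ ≠ 1) (n : ℕ) : ‖∑ k ∈ Finset.Icc 1 n, χ (k : ZMod N)‖ ≤ 2 * N := by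
  have h : ∑ k ∈ Finset.Icc 1 n, χ (k : ZMod N) =
      ∑ k ∈ Finset.range (n + 1), χ (k : ZMod N) - ∑ k ∈ Finset.range 1, χ (k : ZMod N) := by
    rw [← Finset.sum_Ico_eq_sub _ (by omega : 1 ≤ n + 1)]
    rfl
  rw [h]
  refine (norm_sub_le _ _).trans ?_
  linarith [norm_sum_range_le hχ (n + 1), norm_sum_range_le hχ 1]

/-- The `L`-function of a nonprincipal character as an integral, to the right of `0`. -/
lemma DirichletCharacter.LFunction_eq_mul_mellin {N : ℕ} [NeZero N] {χ : DirichletCharacter ℂ N}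
    (hχ : χ ≠ 1) {s : ℂ} (hs : 0 < s.re) :
    DirichletCharacter.LFunction χ s =
      s * mellin (fun t : ℝ => ∑ k ∈ Finset.Icc 1 ⌊t⌋₊, χ (k : ZMod N)) (-s) := by
  set F : ℝ → ℂ := fun t => ∑ k ∈ Finset.Icc 1 ⌊t⌋₊, χ (k : ZMod N) with hF
  have hFb : ∀ t, ‖F t‖ ≤ 2 * N := fun t => norm_sum_Icc_le hχ _
  have hF0 : ∀ t < 1, F t = 0 := by
    intro t ht
    simp [hF, Nat.floor_eq_zero.2 ht]
  have hFm : Measurable F :=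
    (measurable_from_nat (f := fun n : ℕ => ∑ k ∈ Finset.Icc 1 n, χ (k : ZMod N))).comp
      Nat.measurable_floor
  have hFl : LocallyIntegrableOn F (Set.Ioi 0) := by
    refine LocallyIntegrable.locallyIntegrableOn ?_ _
    exact (locallyIntegrable_const (2 * N : ℝ)).mono hFm.aestronglyMeasurable
      (Eventually.of_forall fun t => (hFb t).trans (le_abs_self _))
  have hdiff : ∀ z : ℂ, 0 < z.re → DifferentiableAt ℂ (mellin F) (-z) := by
    intro z hz
    refine mellin_differentiableAt_of_isBigO_rpow (a := 0) (b := -z.re - 1) hFl ?_ (by simpa) ?_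
      (by simp)
    · refine IsBigO.of_bound (2 * N) (Eventually.of_forall fun t => ?_)
      simpa using hFb t
    · refine IsBigO.of_bound 1 ?_
      filter_upwards [mem_nhdsWithin_of_mem_nhds (Iio_mem_nhds (zero_lt_one' ℝ))] with t ht
      rw [hF0 t ht, norm_zero]
      positivity
  have hopen : IsOpen {z : ℂ | 0 < z.re} := isOpen_lt continuous_const Complex.continuous_re
  have hconv : Convex ℝ {z : ℂ | 0 < z.re} := convex_halfSpace_re_gt 0
  have h1 : AnalyticOnNhd ℂ (fun z => z * mellin F (-z)) {z : ℂ | 0 < z.re} := by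
    refine DifferentiableOn.analyticOnNhd (fun z hz => ?_) hopen
    exact (differentiableAt_id.mul ((hdiff z hz).comp z differentiableAt_id.neg)).differentiableWithinAt
  have h2 : AnalyticOnNhd ℂ (DirichletCharacter.LFunction χ) {z : ℂ | 0 < z.re} :=
    fun z _ => (differentiable_LFunction hχ).analyticAt z
  refine h2.eqOn_of_preconnected_of_eventuallyEq h1 hconv.isPreconnected
    (z₀ := 2) (by simp) ?_ hs
  filter_upwards [(isOpen_lt continuous_const Complex.continuous_re).mem_nhds
    (show (1 : ℝ) < (2 : ℂ).re by simp)] with z hz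
  have hz : 1 < z.re := hz
  rw [LFunction_eq_LSeries χ hz, LSeries_eq_mul_integral _ le_rfl (by linarith)
    (LSeriesSummable_of_one_lt_re χ hz)]
  · congr 1
    rw [mellin, ← integral_indicator measurableSet_Ioi, ← integral_indicator measurableSet_Ioi]
    refine integral_congr_ae ?_
    filter_upwards [(measure_eq_zero_iff_ae_notMem).1 (measure_singleton (μ := volume) (1 : ℝ))] with t ht
    have ht1 : t ≠ 1 := ht
    by_cases h : 1 < t
    · rw [Set.indicator_of_mem (show t ∈ Set.Ioi 1 from h),
        Set.indicator_of_mem (show t ∈ Set.Ioi 0 from one_pos.trans h), smul_eq_mul, mul_comm,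
        neg_add']
    · rw [Set.indicator_of_notMem (by simpa using h)]
      have := hF0 t (lt_of_le_of_ne (not_lt.1 h) ht1)
      simp [Set.indicator, this]
  · refine IsBigO.of_bound (2 * N) (Eventually.of_forall fun t => ?_)
    simpa using norm_sum_Icc_le hχ t

/-- A linear bound for the `L`-function of a nonprincipal character. -/
lemma DirichletCharacter.norm_LFunction_le {N : ℕ} [NeZero N] {χ : DirichletCharacter ℂ N}
    (hχ : χ ≠ 1) {s : ℂ} (hs : 1 / 2 ≤ s.re) :
    ‖DirichletCharacter.LFunction χ s‖ ≤ 4 * N * ‖s‖ := by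
  have hs0 : 0 < s.re := by linarith
  rw [LFunction_eq_mul_mellin hχ hs0, norm_mul, mul_comm]
  gcongr
  rw [mellin]
  have hi : IntegrableOn (fun t : ℝ => 2 * (N : ℝ) * t ^ (-s.re - 1)) (Set.Ioi 1) :=
    (integrableOn_Ioi_rpow_of_lt (by linarith) one_pos).const_mul _
  have hb : ∀ t ∈ Set.Ioi (0 : ℝ), ‖(t : ℂ) ^ (-s - 1) • ∑ k ∈ Finset.Icc 1 ⌊t⌋₊, χ (k : ZMod N)‖ ≤
      (Set.Ici (1 : ℝ)).indicator (fun t : ℝ => 2 * (N : ℝ) * t ^ (-s.re - 1)) t := by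
    intro t ht
    by_cases h : t < 1
    · simp [Nat.floor_eq_zero.2 h, h]
    · rw [Set.indicator_of_mem (by simpa using h), norm_smul,
        Complex.norm_cpow_eq_rpow_re_of_pos ht, mul_comm]
      have := norm_sum_Icc_le hχ ⌊t⌋₊
      have ht' : (0 : ℝ) < t := ht
      simp only [Complex.sub_re, Complex.neg_re, Complex.one_re]
      gcongr
  have hi' : IntegrableOn ((Set.Ici (1 : ℝ)).indicator
      (fun t : ℝ => 2 * (N : ℝ) * t ^ (-s.re - 1))) (Set.Ioi 0) :=
    (((integrableOn_Ici_iff_integrableOn_Ioi).2 hi).integrable_indicator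
      measurableSet_Ici).integrableOn
  refine (norm_integral_le_of_norm_le hi' ((ae_restrict_iff' measurableSet_Ioi).2
    (Eventually.of_forall hb))).trans ?_
  rw [setIntegral_indicator measurableSet_Ici,
    Set.inter_eq_self_of_subset_right
      (show Set.Ici (1 : ℝ) ⊆ Set.Ioi 0 from Set.Ici_subset_Ioi.2 one_pos),
    integral_Ici_eq_integral_Ioi, integral_const_mul, integral_Ioi_rpow_of_lt (by linarith) one_pos]
  simp only [Real.one_rpow]
  rw [show -1 / (-s.re - 1 + 1) = 1 / s.re by rw [sub_add_cancel, neg_div_neg_eq]]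
  have : 1 / s.re ≤ 2 := by
    rw [div_le_iff₀ hs0]
    linarith
  have hN : (0 : ℝ) ≤ N := Nat.cast_nonneg _
  nlinarith

/-- A crude form of Stirling's upper bound. -/
lemma Real.Gamma_le_exp_rpow {x : ℝ} (hx : 1 / 4 ≤ x) :
    Real.Gamma x ≤ 4 * Real.exp (2 * (x + 2) ^ (3 / 2 : ℝ)) := by
  have hx0 : 0 < x := by linarith
  have h1 : Real.Gamma x ≤ 4 * Real.Gamma (x + 2) := by
    have e1 := Real.Gamma_add_one hx0.ne'
    have e2 := Real.Gamma_add_one (show x + 1 ≠ 0 by linarith)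
    rw [show x + 2 = x + 1 + 1 by ring, e2, e1]
    have := Real.Gamma_pos_of_pos hx0
    have h3 : 1 ≤ 4 * ((x + 1) * x) := by nlinarith
    nlinarith
  refine h1.trans (mul_le_mul_of_nonneg_left ?_ (by norm_num))
  obtain ⟨n, hn⟩ : ∃ n : ℕ, n = ⌈x⌉₊ + 1 := ⟨_, rfl⟩
  have hn1 : x + 1 ≤ n := by
    rw [hn]; push_cast; linarith [Nat.le_ceil x]
  have hn2 : (n : ℝ) ≤ x + 2 := by
    rw [hn]; push_cast; linarith [Nat.ceil_lt_add_one hx0.le]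
  have h2 : Real.Gamma (x + 2) ≤ Real.Gamma (n + 1) :=
    Real.Gamma_strictMonoOn_Ici.monotoneOn (by simp; linarith) (by simp; linarith) (by linarith)
  rw [Real.Gamma_nat_eq_factorial] at h2
  have h3 : (n.factorial : ℝ) ≤ (n : ℝ) ^ n := by exact_mod_cast n.factorial_le_pow
  have h4 : (n : ℝ) ^ n ≤ (x + 2) ^ (x + 2) := by
    rw [← Real.rpow_natCast]
    calc (n : ℝ) ^ (n : ℝ) ≤ (x + 2) ^ (n : ℝ) := by gcongr
      _ ≤ (x + 2) ^ (x + 2) := Real.rpow_le_rpow_of_exponent_le (by linarith) hn2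
  refine h2.trans (h3.trans (h4.trans ?_))
  have hu : 0 < x + 2 := by linarith
  rw [Real.rpow_def_of_pos hu, Real.exp_le_exp]
  have h5 : Real.log (x + 2) ≤ 2 * (x + 2) ^ (1 / 2 : ℝ) := by
    have := Real.log_le_rpow_div hu.le (show (0 : ℝ) < 1 / 2 by norm_num)
    linarith
  calc Real.log (x + 2) * (x + 2) ≤ 2 * (x + 2) ^ (1 / 2 : ℝ) * (x + 2) := by gcongr
    _ = 2 * (x + 2) ^ (3 / 2 : ℝ) := by
      rw [show (3 / 2 : ℝ) = 1 / 2 + 1 by norm_num, Real.rpow_add hu, Real.rpow_one]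
      ring

lemma Complex.norm_Gamma_le {s : ℂ} (hs : 0 < s.re) : ‖Complex.Gamma s‖ ≤ Real.Gamma s.re := by
  rw [Complex.Gamma_eq_integral hs, Real.Gamma_eq_integral hs, Complex.GammaIntegral]
  refine (norm_integral_le_integral_norm _).trans (le_of_eq ?_)
  refine setIntegral_congr_fun measurableSet_Ioi fun t ht => ?_
  have : (0 : ℝ) < t := ht
  simp only [norm_mul, Complex.norm_cpow_eq_rpow_re_of_pos this]
  rw [Complex.norm_real, Real.norm_of_nonneg (Real.exp_pos _).le]
  simp

lemma Complex.norm_Gammaℝ_le {s : ℂ} (hs : 1 / 2 ≤ s.re) :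
    ‖Complex.Gammaℝ s‖ ≤ 4 * Real.exp (2 * (s.re / 2 + 2) ^ (3 / 2 : ℝ)) := by
  have hre : (s / 2).re = s.re / 2 := by simp
  rw [Complex.Gammaℝ, norm_mul, Complex.norm_cpow_eq_rpow_re_of_pos Real.pi_pos]
  have h1 : Real.pi ^ (-s / 2).re ≤ 1 := by
    refine Real.rpow_le_one_of_one_le_of_nonpos (by linarith [Real.pi_gt_three]) ?_
    simp; linarith
  have h2 := Complex.norm_Gamma_le (s := s / 2) (by rw [hre]; linarith)
  have h3 := Real.Gamma_le_exp_rpow (x := s.re / 2) (by linarith)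
  rw [hre] at h2
  calc _ ≤ 1 * ‖Complex.Gamma (s / 2)‖ := by gcongr
    _ ≤ _ := by rw [one_mul]; exact h2.trans h3

lemma DirichletCharacter.norm_gammaFactor_le {N : ℕ} (χ : DirichletCharacter ℂ N)
    {s : ℂ} (hs : 1 / 2 ≤ s.re) :
    ‖DirichletCharacter.gammaFactor χ s‖ ≤ 4 * Real.exp (2 * (s.re / 2 + 3) ^ (3 / 2 : ℝ)) := by
  rcases χ.even_or_odd with h | h
  · rw [h.gammaFactor_def]
    refine (Complex.norm_Gammaℝ_le hs).trans ?_
    gcongr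
    norm_num
  · rw [h.gammaFactor_def]
    have h1 : (s + 1).re = s.re + 1 := by simp
    refine (Complex.norm_Gammaℝ_le (by rw [h1]; linarith)).trans ?_
    rw [h1]
    exact mul_le_mul_of_nonneg_left (Real.exp_le_exp.2 (mul_le_mul_of_nonneg_left
      (Real.rpow_le_rpow (by linarith) (by linarith) (by norm_num)) (by norm_num))) (by norm_num)

lemma DirichletCharacter.gammaFactor_ne_zero {N : ℕ} (χ : DirichletCharacter ℂ N)
    {s : ℂ} (hs : 0 < s.re) : DirichletCharacter.gammaFactor χ s ≠ 0 := by
  rcases χ.even_or_odd with h | h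
  · rw [h.gammaFactor_def]
    exact Complex.Gammaℝ_ne_zero_of_re_pos hs
  · rw [h.gammaFactor_def]
    exact Complex.Gammaℝ_ne_zero_of_re_pos (by simp; linarith)

lemma DirichletCharacter.completedLFunction_eq {N : ℕ} [NeZero N] (χ : DirichletCharacter ℂ N)
    {s : ℂ} (hs : 0 < s.re) : DirichletCharacter.completedLFunction χ s =
      DirichletCharacter.LFunction χ s * DirichletCharacter.gammaFactor χ s := by
  rw [LFunction_eq_completed_div_gammaFactor χ s (Or.inl fun h => by simp [h] at hs),
    div_mul_cancel₀ _ (gammaFactor_ne_zero χ hs)]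

/-- The completed `L`-function of a Dirichlet character, normalized and centered at `1 / 2`. -/
noncomputable def DirichletCharacter.xi {N : ℕ} [NeZero N] (χ : DirichletCharacter ℂ N) (z : ℂ) :
    ℂ :=
  (N : ℂ) ^ (z / 2) * DirichletCharacter.completedLFunction χ (1 / 2 + z)

lemma DirichletCharacter.differentiable_xi {N : ℕ} [NeZero N] {χ : DirichletCharacter ℂ N}
    (hχ : χ ≠ 1) : Differentiable ℂ (DirichletCharacter.xi χ) := by
  have hN : (N : ℂ) ≠ 0 := NeZero.ne _
  refine Differentiable.mul (fun z => ?_) ?_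
  · exact (differentiableAt_id.div_const 2).const_cpow (Or.inl hN)
  · exact (differentiable_completedLFunction hχ).comp (by fun_prop)

lemma DirichletCharacter.IsPrimitive.xi_neg {N : ℕ} [NeZero N] {χ : DirichletCharacter ℂ N}
    (hχ : χ.IsPrimitive) (z : ℂ) : DirichletCharacter.xi χ (-z) =
      DirichletCharacter.rootNumber χ * DirichletCharacter.xi χ⁻¹ z := by
  have hN : (N : ℂ) ≠ 0 := NeZero.ne _
  have h := hχ.completedLFunction_one_sub (1 / 2 + z)
  rw [xi, xi, show (1 : ℂ) / 2 + -z = 1 - (1 / 2 + z) by ring, h,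
    show (1 : ℂ) / 2 + z - 1 / 2 = z by ring]
  have : (N : ℂ) ^ (-z / 2) * (N : ℂ) ^ z = (N : ℂ) ^ (z / 2) := by
    rw [← Complex.cpow_add _ _ hN]
    congr 1
    ring
  rw [← this]
  ring

/-- The growth of the centered completed `L`-function in the right half plane. -/
lemma DirichletCharacter.norm_xi_le_of_re_nonneg {N : ℕ} [NeZero N] {χ : DirichletCharacter ℂ N}
    (hχ : χ ≠ 1) : ∃ C : ℝ, ∀ z : ℂ, 0 ≤ z.re → 1 ≤ ‖z‖ →
      ‖DirichletCharacter.xi χ z‖ ≤ Real.exp (C * ‖z‖ ^ (3 / 2 : ℝ)) := by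
  have hN : (1 : ℝ) ≤ N := by exact_mod_cast NeZero.one_le
  refine ⟨Real.log N + (Real.log (32 * N) + 16 + 1), fun z hz h1 => ?_⟩
  have hre : (1 / 2 + z).re = 1 / 2 + z.re := by simp
  have hs : 1 / 2 ≤ (1 / 2 + z).re := by rw [hre]; linarith
  have hzr : z.re ≤ ‖z‖ := Complex.re_le_norm z
  set R := ‖z‖ with hR
  have hR0 : 0 < R := by linarith
  have hRR : R ≤ R ^ (3 / 2 : ℝ) := by
    nth_rewrite 1 [← Real.rpow_one R]
    exact Real.rpow_le_rpow_of_exponent_le h1 (by norm_num)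
  have e1 : ‖(N : ℂ) ^ (z / 2)‖ ≤ Real.exp (Real.log N * R) := by
    rw [Complex.norm_natCast_cpow_of_pos (NeZero.pos N), Real.rpow_def_of_pos (by linarith),
      Real.exp_le_exp]
    have := Real.log_nonneg hN
    have h2 : (z / 2).re = z.re / 2 := by simp
    rw [h2]
    gcongr
    linarith
  have e2 : ‖DirichletCharacter.LFunction χ (1 / 2 + z)‖ ≤ 8 * N * Real.exp R := by
    refine (norm_LFunction_le hχ hs).trans ?_
    have h2 : ‖1 / 2 + z‖ ≤ 1 / 2 + R := by
      refine (norm_add_le _ _).trans ?_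
      simp [hR]
    have h3 := Real.add_one_le_exp R
    nlinarith
  have e3 : ‖DirichletCharacter.gammaFactor χ (1 / 2 + z)‖ ≤
      4 * Real.exp (16 * R ^ (3 / 2 : ℝ)) := by
    refine (norm_gammaFactor_le χ hs).trans ?_
    have h2 : ((1 / 2 + z).re / 2 + 3) ^ (3 / 2 : ℝ) ≤ 8 * R ^ (3 / 2 : ℝ) := by
      have h4 : (4 : ℝ) ^ (3 / 2 : ℝ) = 8 := by
        rw [show (4 : ℝ) = 2 ^ (2 : ℝ) by norm_num, ← Real.rpow_mul (by norm_num)]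
        norm_num
      rw [← h4, ← Real.mul_rpow (by norm_num) hR0.le]
      refine Real.rpow_le_rpow (by linarith) ?_ (by norm_num)
      rw [hre]
      linarith
    exact mul_le_mul_of_nonneg_left (Real.exp_le_exp.2 (by linarith)) (by norm_num)
  rw [xi, completedLFunction_eq χ (by linarith), norm_mul, norm_mul]
  calc _ ≤ Real.exp (Real.log N * R) * ((8 * N * Real.exp R) *
        (4 * Real.exp (16 * R ^ (3 / 2 : ℝ)))) := by gcongr
    _ = Real.exp (Real.log N * R + (Real.log (32 * N) + 16 * R ^ (3 / 2 : ℝ) + R)) := by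
      rw [Real.exp_add, Real.exp_add, Real.exp_add, Real.exp_log (by positivity)]
      ring
    _ ≤ _ := by
      rw [Real.exp_le_exp]
      have h2 := Real.log_nonneg hN
      have h3 : 0 ≤ Real.log (32 * N) := Real.log_nonneg (by linarith)
      have h4 : 1 ≤ R ^ (3 / 2 : ℝ) := h1.trans hRR
      nlinarith

/-- The centered completed `L`-function of a primitive character has order at most `3 / 2`. -/
lemma DirichletCharacter.IsPrimitive.norm_xi_le {N : ℕ} [NeZero N] {χ : DirichletCharacter ℂ N}
    (hp : χ.IsPrimitive) (hχ : χ ≠ 1) : ∃ C : ℝ, ∀ z : ℂ, 1 ≤ ‖z‖ →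
      ‖DirichletCharacter.xi χ z‖ ≤ Real.exp (C * ‖z‖ ^ (3 / 2 : ℝ)) := by
  obtain ⟨C₁, h₁⟩ := norm_xi_le_of_re_nonneg hχ
  obtain ⟨C₂, h₂⟩ := norm_xi_le_of_re_nonneg (inv_ne_one.2 hχ)
  set w := ‖DirichletCharacter.rootNumber χ‖ with hw
  have hw0 : 0 ≤ w := norm_nonneg _
  refine ⟨|C₁| + |C₂| + w, fun z hz => ?_⟩
  have hz' : 1 ≤ ‖z‖ ^ (3 / 2 : ℝ) := Real.one_le_rpow hz (by norm_num)
  rcases le_total 0 z.re with h | h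
  · refine (h₁ z h hz).trans (Real.exp_le_exp.2 ?_)
    gcongr
    linarith [le_abs_self C₁, abs_nonneg C₂]
  · have h3 := hp.xi_neg (-z)
    rw [neg_neg] at h3
    rw [h3, norm_mul]
    have h4 := h₂ (-z) (by simpa using h) (by simpa using hz)
    rw [norm_neg] at h4
    have h5 : w ≤ Real.exp (w * ‖z‖ ^ (3 / 2 : ℝ)) := by
      refine le_trans ?_ (Real.add_one_le_exp _)
      nlinarith
    calc _ ≤ Real.exp (w * ‖z‖ ^ (3 / 2 : ℝ)) * Real.exp (C₂ * ‖z‖ ^ (3 / 2 : ℝ)) := by gcongr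
      _ = Real.exp ((w + C₂) * ‖z‖ ^ (3 / 2 : ℝ)) := by rw [← Real.exp_add]; ring_nf
      _ ≤ _ := by
        refine Real.exp_le_exp.2 (mul_le_mul_of_nonneg_right ?_ (by linarith))
        linarith [le_abs_self C₂, abs_nonneg C₁]

lemma zeroMult_eq_analyticOrderNatAt {f : ℂ → ℂ} {s : ℂ} (hf : AnalyticAt ℂ f s)
    (h : analyticOrderAt f s ≠ ⊤) : zeroMult f s = analyticOrderNatAt f s := by
  have hex : ∃ n : ℕ, ∃ g : ℂ → ℂ, AnalyticAt ℂ g s ∧ g s ≠ 0 ∧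
      (∀ᶠ z in nhds s, f z = (z - s) ^ n * g z) := by
    have := (hf.analyticOrderNatAt_eq_iff h).1 rfl
    exact ⟨_, by simpa using this⟩
  rw [zeroMult, dif_pos hex]
  exact ((hf.analyticOrderNatAt_eq_iff h).2 (by simpa using hex.choose_spec)).symm

lemma analyticOrderNatAt_mul_of_ne_zero {f g : ℂ → ℂ} {s : ℂ} (hf : AnalyticAt ℂ f s)
    (hg : AnalyticAt ℂ g s) (h : g s ≠ 0) :
    analyticOrderNatAt (fun z => f z * g z) s = analyticOrderNatAt f s := by
  have : (fun z => f z * g z) = f * g := rfl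
  rw [analyticOrderNatAt, analyticOrderNatAt, this, analyticOrderAt_mul hf hg,
    hg.analyticOrderAt_eq_zero.2 h, add_zero]

namespace DirichletCharacter

lemma differentiable_gammaFactor_inv {N : ℕ} (χ : DirichletCharacter ℂ N) :
    Differentiable ℂ fun s => (gammaFactor χ s)⁻¹ := by
  rcases χ.even_or_odd with h | h
  · simpa only [h.gammaFactor_def] using Complex.differentiable_Gammaℝ_inv
  · simp only [h.gammaFactor_def]
    exact Complex.differentiable_Gammaℝ_inv.comp (differentiable_id.add_const 1)

lemma analyticOrderNatAt_xi {N : ℕ} [NeZero N] {χ : DirichletCharacter ℂ N}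
    (hχ : χ ≠ 1) (γ : ℝ) : analyticOrderNatAt (xi χ) (γ * Complex.I) =
      analyticOrderNatAt (LFunction χ) (1 / 2 + γ * Complex.I) := by
  have hN : (N : ℂ) ≠ 0 := NeZero.ne _
  have hre : 0 < (1 / 2 + (γ : ℂ) * Complex.I).re := by simp
  have hg : Differentiable ℂ fun z : ℂ => (N : ℂ) ^ (-(z / 2)) * (gammaFactor χ (1 / 2 + z))⁻¹ := by
    refine Differentiable.mul (fun z => ?_) ?_
    · exact (differentiableAt_id.div_const 2).neg.const_cpow (Or.inl hN)
    · exact (differentiable_gammaFactor_inv χ).comp (differentiable_id.const_add (1 / 2))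
  rw [← analyticOrderNatAt_mul_of_ne_zero ((differentiable_xi hχ).analyticAt _)
    (hg.analyticAt (γ * Complex.I)) (mul_ne_zero (by simp [Complex.cpow_eq_zero_iff, hN])
      (inv_ne_zero (gammaFactor_ne_zero χ hre)))]
  have hc : analyticOrderAt (LFunction χ ∘ fun z => 1 / 2 + z) (γ * Complex.I) =
      analyticOrderAt (LFunction χ) (1 / 2 + γ * Complex.I) :=
    analyticOrderAt_comp_of_deriv_ne_zero (g := fun z : ℂ => 1 / 2 + z)
      (Differentiable.analyticAt (by fun_prop) _) (by simp)
  rw [analyticOrderNatAt, analyticOrderNatAt, ← hc]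
  congr 1
  refine analyticOrderAt_congr (Eventually.of_forall fun z => ?_)
  change xi χ z * ((N : ℂ) ^ (-(z / 2)) * (gammaFactor χ (1 / 2 + z))⁻¹) = LFunction χ (1 / 2 + z)
  rw [xi, LFunction_eq_completed_div_gammaFactor χ (1 / 2 + z)
    (Or.inr fun h => hχ (level_one' χ h)), Complex.cpow_neg]
  have : (N : ℂ) ^ (z / 2) ≠ 0 := by simp [Complex.cpow_eq_zero_iff, hN]
  field_simp

lemma LFunction_two_ne_zero {N : ℕ} [NeZero N] (χ : DirichletCharacter ℂ N) :
    LFunction χ 2 ≠ 0 :=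
  LFunction_ne_zero_of_one_le_re χ (Or.inr (by norm_num)) (by simp)

lemma zeroMult_LFun {q : ℕ} [NeZero q] {χ : DirichletCharacter ℂ q} (hχ : χ ≠ 1) (s : ℂ) :
    zeroMult (LFun q χ) s = analyticOrderNatAt (LFunction χ) s := by
  have h : LFun q χ = LFunction χ := by
    funext s
    simp [LFun, NeZero.ne q]
  rw [h]
  exact zeroMult_eq_analyticOrderNatAt ((differentiable_LFunction hχ).analyticAt s)
    ((differentiable_LFunction hχ).analyticOrderAt_ne_top (LFunction_two_ne_zero χ) s)

/-- The zeros on the critical line of an `L`-function and of the primitive one inducing it. -/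
lemma analyticOrderNatAt_LFunction_changeLevel {M N : ℕ} [NeZero M] [NeZero N] (hMN : M ∣ N)
    {χ : DirichletCharacter ℂ M} (hχ : χ ≠ 1) {s : ℂ} (hs : 0 < s.re) :
    analyticOrderNatAt (LFunction (changeLevel hMN χ)) s = analyticOrderNatAt (LFunction χ) s := by
  have h : LFunction (changeLevel hMN χ) = fun s =>
      LFunction χ s * ∏ p ∈ N.primeFactors, (1 - χ p * (p : ℂ) ^ (-s)) := by
    funext s
    exact LFunction_changeLevel hMN χ (Or.inl hχ)
  rw [h]
  refine analyticOrderNatAt_mul_of_ne_zero ((differentiable_LFunction hχ).analyticAt s)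
    (Differentiable.analyticAt ?_ s) (Finset.prod_ne_zero_iff.2 fun p hp => ?_)
  · refine Differentiable.fun_finsetProd fun p hp => ?_
    refine (differentiable_const _).sub ((differentiable_const _).mul fun z => ?_)
    exact differentiableAt_id.neg.const_cpow
      (Or.inl (by exact_mod_cast (Nat.prime_of_mem_primeFactors hp).ne_zero))
  · have hp' := Nat.prime_of_mem_primeFactors hp
    intro h0
    have h1 : χ p * (p : ℂ) ^ (-s) = 1 := (sub_eq_zero.1 h0).symm
    have h2 : ‖χ p * (p : ℂ) ^ (-s)‖ < 1 := by
      rw [norm_mul, Complex.norm_natCast_cpow_of_pos hp'.pos]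
      have h3 : (p : ℝ) ^ (-s).re < 1 :=
        Real.rpow_lt_one_of_one_lt_of_neg (by exact_mod_cast hp'.one_lt) (by simpa)
      have h4 := χ.norm_le_one p
      have h5 : 0 ≤ (p : ℝ) ^ (-s).re := by positivity
      nlinarith
    rw [h1, norm_one] at h2
    exact lt_irrefl _ h2

lemma zeroSumInv_changeLevel {M N : ℕ} [NeZero M] [NeZero N] (hMN : M ∣ N)
    {χ : DirichletCharacter ℂ M} (hχ : χ ≠ 1) :
    zeroSumInv N (changeLevel hMN χ) = zeroSumInv M χ := by
  have hχ' : changeLevel hMN χ ≠ 1 := by rwa [Ne, changeLevel_eq_one_iff]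
  rw [zeroSumInv, zeroSumInv]
  congr 1
  funext γ
  rw [zeroMult_LFun hχ, zeroMult_LFun hχ',
    analyticOrderNatAt_LFunction_changeLevel hMN hχ (by simp)]

lemma IsPrimitive.inv {N : ℕ} {χ : DirichletCharacter ℂ N} (h : χ.IsPrimitive) :
    χ⁻¹.IsPrimitive := by
  rwa [isPrimitive_def, conductor_inv]

lemma LFunction_ne_zero_of_GRH (hGRH : GRH) {N : ℕ} [NeZero N] {χ : DirichletCharacter ℂ N}
    (hp : χ.IsPrimitive) (hχ : χ ≠ 1) {s : ℂ} (hs : 1 / 2 < s.re) : LFunction χ s ≠ 0 := by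
  intro h
  rcases le_or_gt 1 s.re with h1 | h1
  · exact LFunction_ne_zero_of_one_le_re χ (Or.inl hχ) h1 h
  · have := hGRH N χ (NeZero.ne N) hp s (by linarith) h1 (by simpa [LFun, NeZero.ne N] using h)
    linarith

lemma xi_ne_zero_of_re_pos (hGRH : GRH) {N : ℕ} [NeZero N] {χ : DirichletCharacter ℂ N}
    (hp : χ.IsPrimitive) (hχ : χ ≠ 1) {z : ℂ} (hz : 0 < z.re) : xi χ z ≠ 0 := by
  have hN : (N : ℂ) ≠ 0 := NeZero.ne _
  have hre : (1 / 2 + z).re = 1 / 2 + z.re := by simp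
  rw [xi, completedLFunction_eq χ (by rw [hre]; linarith)]
  refine mul_ne_zero (by simp [Complex.cpow_eq_zero_iff, hN]) (mul_ne_zero ?_ ?_)
  · exact LFunction_ne_zero_of_GRH hGRH hp hχ (by rw [hre]; linarith)
  · exact gammaFactor_ne_zero χ (by rw [hre]; linarith)

lemma rootNumber_ne_zero_of_GRH (hGRH : GRH) {N : ℕ} [NeZero N] {χ : DirichletCharacter ℂ N}
    (hp : χ.IsPrimitive) (hχ : χ ≠ 1) : rootNumber χ ≠ 0 := by
  intro h
  have h1 := hp.xi_neg (-1)
  rw [neg_neg, h, zero_mul] at h1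
  exact xi_ne_zero_of_re_pos hGRH hp hχ (by simp) h1

lemma re_eq_zero_of_xi_eq_zero (hGRH : GRH) {N : ℕ} [NeZero N] {χ : DirichletCharacter ℂ N}
    (hp : χ.IsPrimitive) (hχ : χ ≠ 1) (z : ℂ) (h : xi χ z = 0) : z.re = 0 := by
  rcases lt_trichotomy z.re 0 with h1 | h1 | h1
  · have h2 := hp.xi_neg (-z)
    rw [neg_neg, h] at h2
    rcases mul_eq_zero.1 h2.symm with h3 | h3
    · exact absurd h3 (rootNumber_ne_zero_of_GRH hGRH hp hχ)
    · exact absurd h3 (xi_ne_zero_of_re_pos hGRH hp.inv (inv_ne_one.2 hχ) (by simpa))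
  · exact h1
  · exact absurd h (xi_ne_zero_of_re_pos hGRH hp hχ h1)

lemma norm_LFunction_sub_one_le {N : ℕ} [NeZero N] (χ : DirichletCharacter ℂ N) {s : ℂ}
    (hs : 2 ≤ s.re) : ‖LFunction χ s - 1‖ ≤ 13 / 20 := by
  have hs1 : 1 < s.re := by linarith
  have hsum := (LSeriesSummable_of_one_lt_re χ hs1).hasSum
  have h1 : HasSum (fun n : ℕ => LSeries.term (fun n => χ n) s n - if n = 1 then 1 else 0)
      (LFunction χ s - 1) := by
    rw [LFunction_eq_LSeries χ hs1]
    exact hsum.sub (hasSum_ite_eq 1 (1 : ℂ))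
  have h2 : HasSum (fun n : ℕ => (1 : ℝ) / (n : ℝ) ^ 2 - if n = 1 then 1 else 0)
      (Real.pi ^ 2 / 6 - 1) := hasSum_zeta_two.sub (hasSum_ite_eq 1 (1 : ℝ))
  have h3 := tsum_of_norm_bounded h2 (f := fun n : ℕ =>
      LSeries.term (fun n => χ n) s n - if n = 1 then 1 else 0) (fun n => ?_)
  · rw [h1.tsum_eq] at h3
    refine h3.trans ?_
    nlinarith [Real.pi_lt_d4, Real.pi_pos]
  · rcases Nat.lt_trichotomy n 1 with hn | rfl | hn
    · have : n = 0 := by omega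
      subst this
      simp
    · simp [LSeries.term]
    · have hn0 : n ≠ 0 := by omega
      have hn' : (1 : ℝ) ≤ n := by exact_mod_cast hn.le
      simp only [hn.ne', if_false, sub_zero]
      rw [LSeries.term_of_ne_zero hn0, norm_div, Complex.norm_natCast_cpow_of_pos (by omega)]
      have h4 := χ.norm_le_one n
      have h5 : (n : ℝ) ^ 2 ≤ (n : ℝ) ^ s.re := by
        rw [← Real.rpow_two]
        exact Real.rpow_le_rpow_of_exponent_le hn' hs
      gcongr

lemma norm_gammaFactor_ratio {N : ℕ} (χ : DirichletCharacter ℂ N) :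
    ∃ c : ℝ, 477 / 100 ≤ c ∧ c ≤ 5 ∧ ‖gammaFactor χ 32‖ = ‖gammaFactor χ 30‖ * c := by
  have hpi1 := Real.pi_gt_d2
  have hpi2 := Real.pi_lt_d4
  rcases χ.even_or_odd with h | h
  · refine ⟨30 / 2 / Real.pi, ?_, ?_, ?_⟩
    · rw [le_div_iff₀ Real.pi_pos]; linarith
    · rw [div_le_iff₀ Real.pi_pos]; linarith
    · rw [h.gammaFactor_def, h.gammaFactor_def, show (32 : ℂ) = 30 + 2 by norm_num,
        Complex.Gammaℝ_add_two (by norm_num)]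
      simp [abs_of_pos Real.pi_pos]
      ring
  · refine ⟨31 / 2 / Real.pi, ?_, ?_, ?_⟩
    · rw [le_div_iff₀ Real.pi_pos]; linarith
    · rw [div_le_iff₀ Real.pi_pos]; linarith
    · rw [h.gammaFactor_def, h.gammaFactor_def, show (32 : ℂ) + 1 = 31 + 2 by norm_num,
        show (30 : ℂ) + 1 = 31 by norm_num, Complex.Gammaℝ_add_two (by norm_num)]
      simp [abs_of_pos Real.pi_pos]
      ring

/-- The growth of `log |ξ|` between two points far to the right. -/
lemma log_norm_xi_sub {N : ℕ} [NeZero N] (χ : DirichletCharacter ℂ N) :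
    Real.log N ≤ Real.log ‖xi χ ((63 / 2 : ℝ) : ℂ)‖ - Real.log ‖xi χ ((59 / 2 : ℝ) : ℂ)‖ ∧
      Real.log ‖xi χ ((63 / 2 : ℝ) : ℂ)‖ - Real.log ‖xi χ ((59 / 2 : ℝ) : ℂ)‖ ≤
        Real.log N + 5 * Real.log 2 := by
  obtain ⟨c, hc1, hc2, hc⟩ := norm_gammaFactor_ratio χ
  have hN : (0 : ℝ) < N := by exact_mod_cast NeZero.pos N
  have hx : ∀ s : ℝ, 0 < s → ‖xi χ ((s - 1 / 2 : ℝ) : ℂ)‖ =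
      (N : ℝ) ^ ((s - 1 / 2) / 2) * (‖LFunction χ s‖ * ‖gammaFactor χ s‖) := by
    intro s hs
    have h1 : (1 / 2 : ℂ) + ((s - 1 / 2 : ℝ) : ℂ) = s := by push_cast; ring
    rw [xi, norm_mul, Complex.norm_natCast_cpow_of_pos (NeZero.pos N), h1,
      completedLFunction_eq χ (by simpa), norm_mul]
    congr 2
    have : (((s - 1 / 2 : ℝ) : ℂ) / 2) = (((s - 1 / 2) / 2 : ℝ) : ℂ) := by push_cast; ring
    rw [this, Complex.ofReal_re]
  have hL : ∀ s : ℝ, 2 ≤ s → 35 / 100 ≤ ‖LFunction χ s‖ ∧ ‖LFunction χ s‖ ≤ 165 / 100 := by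
    intro s hs
    have h1 := norm_LFunction_sub_one_le χ (s := s) (by simpa)
    have h2 := norm_sub_norm_le (LFunction χ s) 1
    have h3 := norm_sub_norm_le 1 (LFunction χ s)
    rw [norm_sub_rev] at h3
    rw [norm_one] at h2 h3
    constructor <;> linarith
  have e1 := hx 32 (by norm_num)
  have e2 := hx 30 (by norm_num)
  obtain ⟨l1, l2⟩ := hL 32 (by norm_num)
  obtain ⟨l3, l4⟩ := hL 30 (by norm_num)
  rw [show (32 - 1 / 2 : ℝ) = 63 / 2 by norm_num] at e1
  rw [show (30 - 1 / 2 : ℝ) = 59 / 2 by norm_num] at e2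
  push_cast at e1 e2 l1 l2 l3 l4 ⊢
  rw [e1, e2, hc]
  have hg : 0 < ‖gammaFactor χ 30‖ := norm_pos_iff.2 (gammaFactor_ne_zero χ (by simp))
  have hp : 0 < (N : ℝ) ^ (59 / 2 / 2 : ℝ) := by positivity
  have hNp : (N : ℝ) ^ (63 / 2 / 2 : ℝ) = N ^ (59 / 2 / 2 : ℝ) * N := by
    rw [show (63 / 2 / 2 : ℝ) = 59 / 2 / 2 + 1 by norm_num, Real.rpow_add hN, Real.rpow_one]
  rw [hNp, ← Real.log_div (by positivity) (by positivity)]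
  have hR : (N : ℝ) ^ (59 / 2 / 2 : ℝ) * N * (‖LFunction χ 32‖ * (‖gammaFactor χ 30‖ * c)) /
      ((N : ℝ) ^ (59 / 2 / 2 : ℝ) * (‖LFunction χ 30‖ * ‖gammaFactor χ 30‖)) =
      N * (c * ‖LFunction χ 32‖ / ‖LFunction χ 30‖) := by
    field_simp
  rw [hR, Real.log_mul (by positivity) (by positivity)]
  have hL30 : 0 < ‖LFunction χ 30‖ := by linarith
  have b1 : 1 ≤ c * ‖LFunction χ 32‖ / ‖LFunction χ 30‖ := by
    rw [le_div_iff₀ hL30]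
    nlinarith
  have b2 : c * ‖LFunction χ 32‖ / ‖LFunction χ 30‖ ≤ 2 ^ 5 := by
    rw [div_le_iff₀ hL30]
    nlinarith
  have b3 := Real.log_nonneg b1
  have b4 := Real.log_le_log (by linarith) b2
  rw [Real.log_pow] at b4
  push_cast at b4
  constructor <;> linarith

/-- The size of the sum over the zeros of a primitive `L`-function in terms of its conductor. -/
lemma IsPrimitive.zeroSumInv_bounds (hGRH : GRH) {N : ℕ} [NeZero N] {χ : DirichletCharacter ℂ N}
    (hp : χ.IsPrimitive) (hχ : χ ≠ 1) :
    Real.log N / 61 ≤ zeroSumInv N χ ∧ zeroSumInv N χ ≤ 396 * Real.log N := by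
  obtain ⟨C, hC⟩ := hp.norm_xi_le hχ
  have hs := hasSum_zeros (differentiable_xi hχ) (re_eq_zero_of_xi_eq_zero hGRH hp hχ) hC
    (x := 59 / 2) (y := 63 / 2) (by norm_num) (by norm_num)
  set D := Real.log ‖xi χ ((63 / 2 : ℝ) : ℂ) * xi χ (-((63 / 2 : ℝ) : ℂ))‖ -
    Real.log ‖xi χ ((59 / 2 : ℝ) : ℂ) * xi χ (-((59 / 2 : ℝ) : ℂ))‖ with hD
  have hN2 : 2 ≤ N := by
    have h1 : N ≠ 1 := fun h => hχ (level_one' χ h)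
    have := NeZero.pos N
    omega
  have hlog2 : Real.log 2 ≤ Real.log N := Real.log_le_log (by norm_num) (by exact_mod_cast hN2)
  have hDval : D = (Real.log ‖xi χ ((63 / 2 : ℝ) : ℂ)‖ - Real.log ‖xi χ ((59 / 2 : ℝ) : ℂ)‖) +
      (Real.log ‖xi χ⁻¹ ((63 / 2 : ℝ) : ℂ)‖ - Real.log ‖xi χ⁻¹ ((59 / 2 : ℝ) : ℂ)‖) := by
    have hv : ∀ t : ℝ, 0 < t → Real.log ‖xi χ t * xi χ (-t)‖ =
        Real.log ‖xi χ t‖ + (Real.log ‖rootNumber χ‖ + Real.log ‖xi χ⁻¹ t‖) := by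
      intro t ht
      have n1 := norm_ne_zero_iff.2 (xi_ne_zero_of_re_pos hGRH hp hχ (z := t) (by simpa))
      have n2 := norm_ne_zero_iff.2
        (xi_ne_zero_of_re_pos hGRH hp.inv (inv_ne_one.2 hχ) (z := t) (by simpa))
      have n3 := norm_ne_zero_iff.2 (rootNumber_ne_zero_of_GRH hGRH hp hχ)
      rw [hp.xi_neg, norm_mul, norm_mul, Real.log_mul n1 (mul_ne_zero n3 n2), Real.log_mul n3 n2]
    rw [hD, hv _ (by norm_num), hv _ (by norm_num)]
    ring
  obtain ⟨d1, d2⟩ := log_norm_xi_sub χ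
  obtain ⟨d3, d4⟩ := log_norm_xi_sub χ⁻¹
  have hm : ∀ γ : ℝ, zeroMult (LFun N χ) (1 / 2 + γ * Complex.I) =
      analyticOrderNatAt (xi χ) (γ * Complex.I) := fun γ => by
    rw [zeroMult_LFun hχ, analyticOrderNatAt_xi hχ]
  set m : ℝ → ℝ := fun γ => (analyticOrderNatAt (xi χ) (γ * Complex.I) : ℝ) with hmdef
  have hm0 : ∀ γ, 0 ≤ m γ := fun γ => Nat.cast_nonneg _
  set t : ℝ → ℝ := fun γ => Real.log (((63 / 2) ^ 2 + γ ^ 2) / ((59 / 2) ^ 2 + γ ^ 2)) with ht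
  have hs' : HasSum (fun γ => m γ * t γ) D := hs
  have ht1 : ∀ γ, t γ ≤ 122 * (1 / (1 / 4 + γ ^ 2)) := by
    intro γ
    have h0 : (0 : ℝ) < (59 / 2) ^ 2 + γ ^ 2 := by positivity
    have h1 := Real.log_le_sub_one_of_pos
      (show 0 < ((63 / 2) ^ 2 + γ ^ 2) / ((59 / 2 : ℝ) ^ 2 + γ ^ 2) by positivity)
    refine h1.trans ?_
    have h2 : ((63 / 2) ^ 2 + γ ^ 2) / ((59 / 2 : ℝ) ^ 2 + γ ^ 2) - 1 =
        122 * (1 / ((59 / 2) ^ 2 + γ ^ 2)) := by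
      field_simp
      ring
    rw [h2]
    gcongr
    norm_num
  have ht2 : ∀ γ, 1 / (1 / 4 + γ ^ 2) ≤ 33 * t γ := by
    intro γ
    have h1 := Real.one_sub_inv_le_log_of_pos
      (show 0 < ((63 / 2) ^ 2 + γ ^ 2) / ((59 / 2 : ℝ) ^ 2 + γ ^ 2) by positivity)
    have h2 : 1 - (((63 / 2) ^ 2 + γ ^ 2) / ((59 / 2 : ℝ) ^ 2 + γ ^ 2))⁻¹ =
        122 / ((63 / 2) ^ 2 + γ ^ 2) := by
      field_simp
      ring
    have h1 : 122 / ((63 / 2) ^ 2 + γ ^ 2) ≤ t γ := h2 ▸ h1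
    have h3 : 1 / (1 / 4 + γ ^ 2) ≤ 33 * (122 / ((63 / 2) ^ 2 + γ ^ 2)) := by
      rw [← mul_div_assoc, div_le_div_iff₀ (by positivity) (by positivity)]
      nlinarith [sq_nonneg γ]
    linarith
  have hz : zeroSumInv N χ = ∑' γ, m γ * (1 / (1 / 4 + γ ^ 2)) := by
    rw [zeroSumInv]
    congr 1
    funext γ
    rw [hm, mul_one_div]
  have hu : ∀ γ, m γ * (1 / (1 / 4 + γ ^ 2)) ≤ 33 * (m γ * t γ) := fun γ => by
    have := mul_le_mul_of_nonneg_left (ht2 γ) (hm0 γ)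
    linarith
  have hsumm : Summable fun γ => m γ * (1 / (1 / 4 + γ ^ 2)) :=
    Summable.of_nonneg_of_le (fun γ => mul_nonneg (hm0 γ) (by positivity)) hu
      (hs'.summable.mul_left 33)
  have hl : ∀ γ, m γ * t γ ≤ 122 * (m γ * (1 / (1 / 4 + γ ^ 2))) := fun γ => by
    have := mul_le_mul_of_nonneg_left (ht1 γ) (hm0 γ)
    linarith
  have b1 := hasSum_le hu hsumm.hasSum (hs'.mul_left 33)
  have b2 := hasSum_le hl hs' (hsumm.hasSum.mul_left 122)
  rw [hz]
  constructor <;> linarith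

/-- The size of the sum over the zeros of an `L`-function in terms of its conductor. -/
lemma zeroSumInv_bounds (hGRH : GRH) {q : ℕ} [NeZero q] {χ : DirichletCharacter ℂ q}
    (hχ : χ ≠ 1) : Real.log χ.conductor / 61 ≤ zeroSumInv q χ ∧
      zeroSumInv q χ ≤ 396 * Real.log χ.conductor := by
  have : NeZero χ.conductor := ⟨χ.conductor_ne_zero⟩
  have h : χ.primitiveCharacter ≠ 1 := fun h => hχ (by
    rw [← χ.changeLevel_primitiveCharacter, h, changeLevel_one])
  have h1 := χ.primitiveCharacter_isPrimitive.zeroSumInv_bounds hGRH h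
  rwa [← zeroSumInv_changeLevel χ.conductor_dvd_level h, changeLevel_primitiveCharacter] at h1

end DirichletCharacter

namespace DirichletCharacter

lemma starRingEnd_apply_unit {q : ℕ} [NeZero q] (χ : DirichletCharacter ℂ q) (u : (ZMod q)ˣ) :
    (starRingEnd ℂ) (χ u) = χ ((u : ZMod q)⁻¹) := by
  rw [← Complex.inv_eq_conj (χ.unit_norm_eq_one u), ZMod.inv_coe_unit]
  refine (eq_inv_of_mul_eq_one_left ?_).symm
  rw [← map_mul, Units.inv_mul, map_one]

/-- The mean square of a linear combination of character values. -/
lemma sum_norm_sq_eq {q k : ℕ} [NeZero q] {a : Fin k → (ZMod q)ˣ} (ha : Function.Injective a)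
    (α : Fin k → ℝ) : ∑ χ : DirichletCharacter ℂ q, ‖∑ i, (α i : ℂ) * χ (a i : ZMod q)‖ ^ 2 =
      q.totient * ∑ i, α i ^ 2 := by
  have h : ∀ χ : DirichletCharacter ℂ q, ((‖∑ i, (α i : ℂ) * χ (a i : ZMod q)‖ ^ 2 : ℝ) : ℂ) =
      ∑ i, ∑ j, (α i : ℂ) * α j * (χ ((a i : ZMod q)⁻¹) * χ (a j : ZMod q)) := by
    intro χ
    rw [Complex.ofReal_pow, ← Complex.conj_mul', map_sum, Finset.sum_mul_sum]
    refine Finset.sum_congr rfl fun i _ => Finset.sum_congr rfl fun j _ => ?_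
    rw [map_mul, Complex.conj_ofReal, starRingEnd_apply_unit]
    ring
  apply Complex.ofReal_injective
  push_cast
  rw [Finset.sum_congr rfl fun χ _ => by rw [← Complex.ofReal_pow, h χ], Finset.sum_comm,
    Finset.mul_sum]
  refine Finset.sum_congr rfl fun i _ => ?_
  have h2 : ∀ j, ∑ χ : DirichletCharacter ℂ q,
      (α i : ℂ) * α j * (χ ((a i : ZMod q)⁻¹) * χ (a j : ZMod q)) =
        if i = j then (q.totient : ℂ) * (α i : ℂ) ^ 2 else 0 := by
    intro j
    rw [← Finset.mul_sum, sum_char_inv_mul_char_eq ℂ (a i).isUnit]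
    by_cases hij : i = j
    · subst hij
      simp
      ring
    · have : (a i : ZMod q) ≠ a j := fun h => hij (ha (Units.ext h))
      simp [hij, this]
  rw [Finset.sum_comm, Finset.sum_congr rfl fun j _ => h2 j]
  simp

lemma norm_sq_le {q k : ℕ} (χ : DirichletCharacter ℂ q) (a : Fin k → (ZMod q)ˣ)
    (α : Fin k → ℝ) : ‖∑ i, (α i : ℂ) * χ (a i : ZMod q)‖ ^ 2 ≤ k * ∑ i, α i ^ 2 := by
  have h1 : ‖∑ i, (α i : ℂ) * χ (a i : ZMod q)‖ ≤ ∑ i, |α i| := by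
    refine norm_sum_le_of_le _ fun i _ => ?_
    rw [norm_mul, Complex.norm_real, Real.norm_eq_abs]
    exact mul_le_of_le_one_right (abs_nonneg _) (χ.norm_le_one _)
  calc _ ≤ (∑ i, |α i|) ^ 2 := by gcongr
    _ ≤ _ := by
      have := sq_sum_le_card_mul_sum_sq (s := Finset.univ) (f := fun i => |α i|)
      simpa using this

/-- There are few characters of small conductor. -/
lemma card_conductor_le (q : ℕ) [NeZero q] (Y : ℕ) :
    (Finset.univ.filter fun χ : DirichletCharacter ℂ q => χ.conductor ≤ Y).card ≤ Y * Y := by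
  have himg : ((Finset.univ.filter fun χ : DirichletCharacter ℂ q => χ.conductor ≤ Y).image
      conductor).card ≤ Y := by
    refine (Finset.card_le_card (t := Finset.Icc 1 Y) ?_).trans (by simp)
    intro d hd
    obtain ⟨χ, hχ, rfl⟩ := Finset.mem_image.1 hd
    exact Finset.mem_Icc.2 ⟨Nat.one_le_iff_ne_zero.2 χ.conductor_ne_zero, (Finset.mem_filter.1 hχ).2⟩
  refine (Finset.card_le_mul_card_image _ Y fun d hd => ?_).trans (Nat.mul_le_mul_left Y himg)
  obtain ⟨χ, hχ, rfl⟩ := Finset.mem_image.1 hd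
  have : NeZero χ.conductor := ⟨χ.conductor_ne_zero⟩
  have hsub : (Finset.univ.filter fun χ : DirichletCharacter ℂ q => χ.conductor ≤ Y).filter
      (fun ψ => ψ.conductor = χ.conductor) ⊆
        Finset.univ.image (changeLevel (R := ℂ) χ.conductor_dvd_level) := by
    intro ψ hψ
    obtain ⟨_, ψ₀, hψ₀⟩ := (Finset.mem_filter.1 hψ).2 ▸ ψ.factorsThrough_conductor
    exact Finset.mem_image.2 ⟨ψ₀, Finset.mem_univ _, hψ₀.symm⟩
  refine (Finset.card_le_card hsub).trans (Finset.card_image_le.trans ?_)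
  rw [Finset.card_univ, ← Nat.card_eq_fintype_card, card_eq_totient_of_hasEnoughRootsOfUnity]
  exact (Nat.totient_le _).trans (Finset.mem_filter.1 hχ).2

end DirichletCharacter

lemma Vgen_eq_sum {q k : ℕ} [NeZero q] (a : Fin k → (ZMod q)ˣ) {α : Fin k → ℝ}
    (hα : ∑ i, α i = 0) : Vgen q k a α = ∑ χ : DirichletCharacter ℂ q,
      ‖∑ i, (α i : ℂ) * χ (a i : ZMod q)‖ ^ 2 * zeroSumInv q χ := by
  rw [Vgen, finsum_mem_def, finsum_eq_sum_of_fintype]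
  refine Finset.sum_congr rfl fun χ _ => ?_
  by_cases h : χ = 1
  · have h0 : ∑ i, (α i : ℂ) = 0 := by exact_mod_cast hα
    simp [h, h0]
  · simp [h]

lemma log_three_mul_div_le {φ k : ℕ} (hφ : 0 < φ) (hk : 0 < k) {B : ℝ}
    (h2 : Real.log 2 ≤ B) (hY : ∀ Y : ℕ, 1 ≤ Y → Y * Y * (2 * k) ≤ φ → Real.log Y ≤ 2 * B) :
    Real.log (3 * (φ : ℝ) / k) ≤ 9 * B := by
  set Y := Nat.sqrt (φ / (2 * k)) with hYdef
  have h1 : Y * Y * (2 * k) ≤ φ :=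
    (Nat.mul_le_mul_right _ (Nat.sqrt_le _)).trans (Nat.div_mul_le_self _ _)
  have h3 : φ < (Y + 1) * (Y + 1) * (2 * k) := by
    rw [← Nat.div_lt_iff_lt_mul (by omega)]
    exact Nat.lt_succ_sqrt _
  have hk' : (0 : ℝ) < k := by exact_mod_cast hk
  have hφ' : (0 : ℝ) < φ := by exact_mod_cast hφ
  have h3' : (φ : ℝ) ≤ (Y + 1) * (Y + 1) * (2 * k) := by exact_mod_cast h3.le
  have hlog2 : 0 < Real.log 2 := Real.log_pos (by norm_num)
  rcases Nat.eq_zero_or_pos Y with h0 | h0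
  · have : 3 * (φ : ℝ) / k ≤ 2 ^ 3 := by
      rw [div_le_iff₀ hk']
      rw [h0] at h3'
      push_cast at h3'
      linarith
    have := Real.log_le_log (by positivity) this
    rw [Real.log_pow] at this
    push_cast at this
    linarith
  · have hY1 : (1 : ℝ) ≤ Y := by exact_mod_cast h0
    have : 3 * (φ : ℝ) / k ≤ 2 ^ 5 * (Y : ℝ) ^ 2 := by
      rw [div_le_iff₀ hk']
      have : ((Y : ℝ) + 1) * (Y + 1) ≤ 4 * Y ^ 2 := by nlinarith
      nlinarith
    have := Real.log_le_log (by positivity) this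
    rw [Real.log_mul (by norm_num) (by positivity), Real.log_pow, Real.log_pow] at this
    push_cast at this
    linarith [hY Y h0 h1]

theorem variance_bounds_general (hGRH : GRH) :
    ∃ c₁ c₂ : ℝ, 0 < c₁ ∧ 0 < c₂ ∧
      ∀ (q : ℕ), 3 ≤ q → LI q →
        ∀ (k : ℕ) (a : Fin k → (ZMod q)ˣ) (α : Fin k → ℝ),
          Function.Injective a → α ≠ 0 → (∑ i, α i) = 0 →
          c₁ * (q.totient : ℝ) * (∑ i, (α i) ^ 2) *
              Real.log (3 * (q.totient : ℝ) / k) ≤ Vgen q k a α ∧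
            Vgen q k a α ≤ c₂ * (q.totient : ℝ) * (∑ i, (α i) ^ 2) * Real.log q := by
  refine ⟨1 / 549, 396, by norm_num, by norm_num, ?_⟩
  intro q hq _ k a α ha hα hsum
  have : NeZero q := ⟨by omega⟩
  rw [Vgen_eq_sum a hsum]
  set W : DirichletCharacter ℂ q → ℝ := fun χ => ‖∑ i, (α i : ℂ) * χ (a i : ZMod q)‖ ^ 2 with hW
  set S := ∑ i, α i ^ 2 with hS
  have hW0 : ∀ χ, 0 ≤ W χ := fun χ => sq_nonneg _
  have hWsum : ∑ χ, W χ = q.totient * S := DirichletCharacter.sum_norm_sq_eq ha α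
  have hWle : ∀ χ, W χ ≤ k * S := fun χ => χ.norm_sq_le a α
  have hW1 : W 1 = 0 := by
    have h0 : ∑ i, (α i : ℂ) = 0 := by exact_mod_cast hsum
    simp [hW, h0]
  obtain ⟨i, hi⟩ := Function.ne_iff.1 hα
  have hi : α i ≠ 0 := hi
  have hSpos : 0 < S := Finset.sum_pos' (fun _ _ => sq_nonneg _)
    ⟨i, Finset.mem_univ _, by positivity⟩
  have hk : 0 < k := i.pos
  have hφ : 0 < q.totient := Nat.totient_pos.2 (by omega)
  have hφ' : (0 : ℝ) < q.totient := by exact_mod_cast hφ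
  have hterm : ∀ χ : DirichletCharacter ℂ q, W χ * (Real.log χ.conductor / 61) ≤
      W χ * zeroSumInv q χ := by
    intro χ
    by_cases h : χ = 1
    · simp [h, hW1]
    · exact mul_le_mul_of_nonneg_left (DirichletCharacter.zeroSumInv_bounds hGRH h).1 (hW0 χ)
  have hlogc : ∀ χ : DirichletCharacter ℂ q, 0 ≤ Real.log χ.conductor := fun χ =>
    Real.log_natCast_nonneg _
  constructor
  · set V := ∑ χ, W χ * zeroSumInv q χ with hV
    have hlow : ∑ χ : DirichletCharacter ℂ q, W χ * (Real.log χ.conductor / 61) ≤ V :=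
      Finset.sum_le_sum fun χ _ => hterm χ
    have hB := log_three_mul_div_le hφ hk (B := 61 * V / (q.totient * S)) ?_ ?_
    · rw [← mul_div_assoc, le_div_iff₀ (by positivity)] at hB
      linarith
    · rw [le_div_iff₀ (by positivity), ← hWsum, Finset.mul_sum]
      have : ∑ χ, Real.log 2 * W χ ≤
          61 * ∑ χ : DirichletCharacter ℂ q, W χ * (Real.log χ.conductor / 61) := by
        rw [Finset.mul_sum]
        refine Finset.sum_le_sum fun χ _ => ?_
        by_cases h : χ = 1
        · simp [h, hW1]
        · have hc : 2 ≤ χ.conductor := by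
            have h1 : χ.conductor ≠ 1 := fun h' =>
              h (DirichletCharacter.eq_one_iff_conductor_eq_one.2 h')
            have := χ.conductor_ne_zero
            omega
          have := Real.log_le_log (by norm_num) (show (2 : ℝ) ≤ χ.conductor by exact_mod_cast hc)
          have := mul_le_mul_of_nonneg_left this (hW0 χ)
          linarith
      linarith
    · intro Y hY1 hY
      rw [← mul_div_assoc, le_div_iff₀ (by positivity)]
      have hlogY : 0 ≤ Real.log Y := Real.log_natCast_nonneg _
      have hsplit := Finset.sum_filter_add_sum_filter_not Finset.univ
        (fun χ : DirichletCharacter ℂ q => χ.conductor ≤ Y) W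
      have hsmall : ∑ χ : DirichletCharacter ℂ q with χ.conductor ≤ Y, W χ ≤
          q.totient * S / 2 := by
        refine (Finset.sum_le_card_nsmul _ _ _ fun χ _ => hWle χ).trans ?_
        rw [nsmul_eq_mul]
        have h1 : ((Finset.univ.filter fun χ : DirichletCharacter ℂ q =>
            χ.conductor ≤ Y).card : ℝ) ≤ Y * Y := by
          exact_mod_cast DirichletCharacter.card_conductor_le q Y
        have h2 : (Y : ℝ) * Y * (2 * k) ≤ q.totient := by exact_mod_cast hY
        have h3 : (0 : ℝ) ≤ k * S := by positivity
        nlinarith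
      have hbig : ∑ χ : DirichletCharacter ℂ q with ¬ χ.conductor ≤ Y, W χ * (Real.log Y / 61) ≤
          ∑ χ : DirichletCharacter ℂ q, W χ * (Real.log χ.conductor / 61) := by
        refine (Finset.sum_le_sum fun χ hχ => ?_).trans (Finset.sum_le_sum_of_subset_of_nonneg
          (Finset.filter_subset _ _) fun χ _ _ => mul_nonneg (hW0 χ) (by linarith [hlogc χ]))
        have hc : Y ≤ χ.conductor := (not_le.1 (Finset.mem_filter.1 hχ).2).le
        have := Real.log_le_log (by exact_mod_cast hY1) (show (Y : ℝ) ≤ χ.conductor by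
          exact_mod_cast hc)
        exact mul_le_mul_of_nonneg_left (by linarith) (hW0 χ)
      rw [← Finset.sum_mul] at hbig
      nlinarith
  · calc ∑ χ, W χ * zeroSumInv q χ ≤ ∑ χ, W χ * (396 * Real.log q) := by
          refine Finset.sum_le_sum fun χ _ => ?_
          by_cases h : χ = 1
          · simp [h, hW1]
          · refine mul_le_mul_of_nonneg_left ?_ (hW0 χ)
            have h1 := (DirichletCharacter.zeroSumInv_bounds hGRH h).2
            have hc : (χ.conductor : ℝ) ≤ q := by
              exact_mod_cast Nat.le_of_dvd (by omega) χ.conductor_dvd_level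
            have h2 := Real.log_le_log
              (by exact_mod_cast Nat.pos_of_ne_zero χ.conductor_ne_zero) hc
            linarith
      _ = 396 * (q.totient : ℝ) * S * Real.log q := by
        rw [← Finset.sum_mul, hWsum]
        ring
end

section
/- Let q ≥ 3, let a₁,…,a_k be distinct invertible residues mod q, and let α₁,…,α_k be real numbers. Then Σ_{χ mod q} |α₁χ(a₁)+…+α_kχ(a_k)|²·log q*(χ) = φ(q)·(Σ_{i=1}^k α_i²)·(log q − Σ_{p | q} (log p)/(p−1)) − φ(q)·Σ_{i ≠ j} α_i α_j · Λ(q/gcd(q, a_i a_j^{−1} − 1))/φ(q/gcd(q, a_i a_j^{−1} − 1)), where the outer sum runs over all Dirichlet characters χ mod q, q*(χ) denotes the conductor of χ, Λ is the von Mangoldt function, and a_i a_j^{−1} − 1 is computed in ℤ/qℤ (with gcd(q, b) meaning the gcd of q with any integer representative of b). -/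
open Filter Topology MeasureTheory

open scoped Classical
open Asymptotics

open ArithmeticFunction (vonMangoldt) in
theorem sum_divisors_primePow_dvd_vonMangoldt_mul_totient {p r n c : ℕ} (hp : p.Prime)
    (hr : r ≠ 0) (hc : c ≠ 0) (hpc : p.Coprime c) :
    ∑ d ∈ (p ^ (r + n) * c).divisors with p ^ r ∣ d,
        vonMangoldt d * ((p ^ (r + n) * c / d).totient : ℝ) =
      Real.log p * (p ^ n * c.totient : ℝ) := by
  have hinj : Set.InjOn (fun i ↦ p ^ (r + n - i)) (Finset.range (n + 1)) := by
    intro i hi j hj hij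
    have := Nat.pow_right_injective hp.two_le hij
    simp only [Finset.coe_range, Set.mem_Iio] at hi hj
    omega
  have hsub : (Finset.range (n + 1)).image (fun i ↦ p ^ (r + n - i)) ⊆
      (p ^ (r + n) * c).divisors.filter (p ^ r ∣ ·) := by
    intro d hd
    obtain ⟨i, hi, rfl⟩ := Finset.mem_image.mp hd
    rw [Finset.mem_range] at hi
    simp only [Finset.mem_filter, Nat.mem_divisors]
    exact ⟨⟨(pow_dvd_pow p (by omega)).mul_right c,
      mul_ne_zero (pow_ne_zero _ hp.ne_zero) hc⟩, pow_dvd_pow p (by omega)⟩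
  rw [← Finset.sum_subset hsub, Finset.sum_image hinj]
  · have hterm : ∀ i ∈ Finset.range (n + 1),
        vonMangoldt (p ^ (r + n - i)) *
          ((p ^ (r + n) * c / p ^ (r + n - i)).totient : ℝ) =
        Real.log p * c.totient * ((p ^ i).totient : ℝ) := by
      intro i hi
      rw [Finset.mem_range] at hi
      have hdiv : p ^ (r + n) * c / p ^ (r + n - i) = p ^ i * c := by
        apply Nat.div_eq_of_eq_mul_right (pow_pos hp.pos _)
        rw [← mul_assoc, ← pow_add]
        congr 2
        omega
      rw [hdiv, ArithmeticFunction.vonMangoldt_apply_pow (by omega),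
        ArithmeticFunction.vonMangoldt_apply_prime hp,
        Nat.totient_mul (hpc.pow_left i)]
      push_cast
      ring
    have htot : ∑ i ∈ Finset.range (n + 1), (p ^ i).totient = p ^ n := by
      rw [← Nat.sum_divisors_prime_pow (f := Nat.totient) hp, Nat.sum_totient]
    rw [Finset.sum_congr rfl hterm, ← Finset.mul_sum, ← Nat.cast_sum, htot]
    push_cast
    ring
  · intro d hd hd'
    rw [Finset.mem_filter, Nat.mem_divisors] at hd
    rw [ArithmeticFunction.vonMangoldt_eq_zero_iff.mpr, zero_mul]
    intro hpp
    obtain ⟨l, k, hl, hk, rfl⟩ := (isPrimePow_nat_iff d).mp hpp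
    have hpl : p = l := (Nat.prime_dvd_prime_iff_eq hp hl).mp
      (hp.dvd_of_dvd_pow ((dvd_pow_self p hr).trans hd.2))
    subst hpl
    have hrk : r ≤ k := (Nat.pow_dvd_pow_iff_le_right hp.one_lt).mp hd.2
    have hkn : k ≤ r + n := (Nat.pow_dvd_pow_iff_le_right hp.one_lt).mp
      ((hpc.pow_left k).dvd_of_dvd_mul_right hd.1.1)
    refine hd' (Finset.mem_image.mpr ⟨r + n - k, Finset.mem_range.mpr (by omega), ?_⟩)
    congr 1
    omega

open ArithmeticFunction (vonMangoldt) in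
theorem sum_divisors_dvd_vonMangoldt_mul_totient {q m : ℕ} (hq : q ≠ 0) (hm : m ∣ q)
    (hm1 : m ≠ 1) :
    ∑ d ∈ q.divisors with m ∣ d, vonMangoldt d * ((q / d).totient : ℝ) =
      q.totient * (vonMangoldt m / m.totient) := by
  by_cases hpp : IsPrimePow m
  · obtain ⟨p, r, hp, hr, rfl⟩ := (isPrimePow_nat_iff m).mp hpp
    obtain ⟨v, c, hpc, rfl⟩ := Nat.exists_eq_pow_mul_and_not_dvd hq p hp.ne_one
    have hcop : p.Coprime c := (hp.coprime_iff_not_dvd).mpr hpc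
    have hrv : r ≤ v := (Nat.pow_dvd_pow_iff_le_right hp.one_lt).mp
      ((hcop.pow_left r).dvd_of_dvd_mul_right hm)
    obtain ⟨n, rfl⟩ := Nat.exists_eq_add_of_le hrv
    rw [sum_divisors_primePow_dvd_vonMangoldt_mul_totient hp hr.ne'
        (right_ne_zero_of_mul hq) hcop,
      ArithmeticFunction.vonMangoldt_apply_pow hr.ne',
      ArithmeticFunction.vonMangoldt_apply_prime hp, Nat.totient_mul (hcop.pow_left _)]
    have htot : (p ^ (r + n)).totient = p ^ n * (p ^ r).totient := by
      rw [Nat.totient_prime_pow hp (by omega), Nat.totient_prime_pow hp hr, ← mul_assoc,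
        ← pow_add]
      congr 2
      omega
    have hne : ((p ^ r).totient : ℝ) ≠ 0 := by
      exact_mod_cast (Nat.totient_pos.mpr (pow_pos hp.pos r)).ne'
    rw [htot]
    push_cast
    field_simp
  · rw [ArithmeticFunction.vonMangoldt_eq_zero_iff.mpr hpp, zero_div, mul_zero]
    refine Finset.sum_eq_zero fun d hd ↦ ?_
    rw [ArithmeticFunction.vonMangoldt_eq_zero_iff.mpr, zero_mul]
    exact fun h ↦ hpp (h.dvd (Finset.mem_filter.mp hd).2 hm1)

open ArithmeticFunction (vonMangoldt) in
theorem sum_divisors_vonMangoldt_mul_totient {q : ℕ} (hq : q ≠ 0) :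
    ∑ d ∈ q.divisors, vonMangoldt d * ((q / d).totient : ℝ) =
      q.totient * ∑ p ∈ q.primeFactors, Real.log p / ((p : ℝ) - 1) := by
  have hprime : ∀ p ∈ q.primeFactors,
      (q.totient : ℝ) * (Real.log p / ((p : ℝ) - 1)) =
        ∑ d ∈ q.divisors, if p ∣ d then vonMangoldt d * ((q / d).totient : ℝ) else 0 := by
    intro p hp
    have hp' := Nat.prime_of_mem_primeFactors hp
    rw [← Finset.sum_filter, sum_divisors_dvd_vonMangoldt_mul_totient hq
        (Nat.dvd_of_mem_primeFactors hp) hp'.ne_one,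
      ArithmeticFunction.vonMangoldt_apply_prime hp', Nat.totient_prime hp',
      Nat.cast_sub hp'.one_le, Nat.cast_one]
  rw [Finset.mul_sum, Finset.sum_congr rfl hprime, Finset.sum_comm]
  refine Finset.sum_congr rfl fun d hd ↦ ?_
  by_cases hpp : IsPrimePow d
  · obtain ⟨l, k, hl, hk, rfl⟩ := (isPrimePow_nat_iff d).mp hpp
    have hlq : l ∣ q := (dvd_pow_self l hk.ne').trans (Nat.dvd_of_mem_divisors hd)
    rw [Finset.sum_eq_single_of_mem l (Nat.mem_primeFactors.mpr ⟨hl, hlq, hq⟩),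
      if_pos (dvd_pow_self l hk.ne')]
    intro p hp hpl
    refine if_neg fun h ↦ hpl ?_
    exact (Nat.prime_dvd_prime_iff_eq (Nat.prime_of_mem_primeFactors hp) hl).mp
      ((Nat.prime_of_mem_primeFactors hp).dvd_of_dvd_pow h)
  · simp [ArithmeticFunction.vonMangoldt_eq_zero_iff.mpr hpp]

namespace DirichletCharacter

theorem log_conductor {q : ℕ} (hq : q ≠ 0) (χ : DirichletCharacter ℂ q) :
    Real.log χ.conductor = Real.log q -
      ∑ d ∈ q.divisors with χ.conductor ∣ q / d, ArithmeticFunction.vonMangoldt d := by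
  obtain ⟨e, he⟩ := χ.conductor_dvd_level
  have hc : χ.conductor ≠ 0 := left_ne_zero_of_mul (he ▸ hq)
  have he0 : e ≠ 0 := right_ne_zero_of_mul (he ▸ hq)
  have hset : q.divisors.filter (fun d ↦ χ.conductor ∣ q / d) = e.divisors := by
    ext d
    rw [Finset.mem_filter, Nat.mem_divisors, Nat.mem_divisors]
    constructor
    · rintro ⟨⟨hd, -⟩, h⟩
      refine ⟨?_, he0⟩
      rw [Nat.dvd_div_iff_mul_dvd hd] at h
      nth_rewrite 2 [he] at h
      rw [mul_comm] at h
      exact Nat.dvd_of_mul_dvd_mul_left (Nat.pos_of_ne_zero hc) h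
    · rintro ⟨hd, -⟩
      have hdq : d ∣ q := he ▸ hd.mul_left _
      refine ⟨⟨hdq, hq⟩, ?_⟩
      rw [Nat.dvd_div_iff_mul_dvd hdq]
      nth_rewrite 2 [he]
      rw [mul_comm]
      exact mul_dvd_mul_left _ hd
  have hlog : Real.log q = Real.log χ.conductor + Real.log e := by
    rw [← Real.log_mul (by exact_mod_cast hc) (by exact_mod_cast he0)]
    exact_mod_cast congrArg (fun n : ℕ ↦ Real.log n) he
  rw [hset, ArithmeticFunction.vonMangoldt_sum, hlog]
  ring

theorem sum_apply_of_conductor_dvd {q e : ℕ} [NeZero q] (he : e ∣ q) (u : (ZMod q)ˣ) :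
    ∑ χ : DirichletCharacter ℂ q with χ.conductor ∣ e, χ (u : ZMod q) =
      if e ∣ q.gcd ((u : ZMod q) - 1).val then (e.totient : ℂ) else 0 := by
  have : NeZero e := ⟨fun h ↦ NeZero.ne q (Nat.eq_zero_of_zero_dvd (h ▸ he))⟩
  have himage : Finset.univ.filter (fun χ : DirichletCharacter ℂ q ↦ χ.conductor ∣ e) =
      Finset.univ.image (changeLevel he) := by
    ext χ
    simp only [Finset.mem_filter, Finset.mem_univ, true_and, Finset.mem_image]
    rw [← mem_conductorSet_iff_conductor_dvd χ he]
    constructor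
    · rintro ⟨_, χ₀, rfl⟩
      exact ⟨χ₀, rfl⟩
    · rintro ⟨χ₀, rfl⟩
      exact ⟨he, χ₀, rfl⟩
  rw [himage, Finset.sum_image (changeLevel_injective he).injOn]
  simp only [changeLevel_eq_cast_of_dvd]
  rw [sum_characters_eq]
  refine if_congr ?_ rfl rfl
  rw [Nat.dvd_gcd_iff, and_iff_right he, ← ZMod.natCast_eq_zero_iff,
    ZMod.natCast_val, ZMod.cast_sub he, ZMod.cast_one he, sub_eq_zero]

theorem sum_apply_mul_log_conductor {q : ℕ} [NeZero q] (u : (ZMod q)ˣ) :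
    ∑ χ : DirichletCharacter ℂ q, χ (u : ZMod q) * (Real.log χ.conductor : ℂ) =
      ((if u = 1 then (q.totient : ℝ) * Real.log q else 0) -
        ∑ d ∈ q.divisors with q / q.gcd ((u : ZMod q) - 1).val ∣ d,
          ArithmeticFunction.vonMangoldt d * ((q / d).totient : ℝ) : ℝ) := by
  have hq := NeZero.ne q
  have hexpand : ∀ χ : DirichletCharacter ℂ q,
      χ (u : ZMod q) * (Real.log χ.conductor : ℂ) = χ (u : ZMod q) * (Real.log q : ℂ) -
        ∑ d ∈ q.divisors, if χ.conductor ∣ q / d then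
          (ArithmeticFunction.vonMangoldt d : ℂ) * χ (u : ZMod q) else 0 := by
    intro χ
    rw [log_conductor hq, ← Finset.sum_filter, Complex.ofReal_sub, mul_sub,
      Complex.ofReal_sum, Finset.mul_sum]
    simp only [mul_comm]
  rw [Finset.sum_congr rfl fun χ _ ↦ hexpand χ, Finset.sum_sub_distrib, ← Finset.sum_mul,
    sum_characters_eq, Finset.sum_comm, Complex.ofReal_sub]
  congr 1
  · by_cases hu : u = 1 <;> simp [hu]
  · rw [Complex.ofReal_sum, Finset.sum_filter]
    refine Finset.sum_congr rfl fun d hd ↦ ?_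
    have hdq := Nat.dvd_of_mem_divisors hd
    rw [← Finset.sum_filter, ← Finset.mul_sum,
      sum_apply_of_conductor_dvd (Nat.div_dvd_of_dvd hdq), mul_ite, mul_zero]
    have hiff : q / d ∣ q.gcd ((u : ZMod q) - 1).val ↔
        q / q.gcd ((u : ZMod q) - 1).val ∣ d := by
      have hg := Nat.gcd_dvd_left q ((u : ZMod q) - 1).val
      rw [Nat.div_dvd_iff_dvd_mul hdq (Nat.pos_of_mem_divisors hd),
        Nat.div_dvd_iff_dvd_mul hg (Nat.pos_of_dvd_of_pos hg (Nat.pos_of_ne_zero hq)), mul_comm]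
    rw [if_congr hiff rfl rfl]
    push_cast
    rfl

theorem sum_apply_one_mul_log_conductor {q : ℕ} [NeZero q] :
    ∑ χ : DirichletCharacter ℂ q, χ ((1 : (ZMod q)ˣ) : ZMod q) * (Real.log χ.conductor : ℂ) =
      ((q.totient : ℝ) *
        (Real.log q - ∑ p ∈ q.primeFactors, Real.log p / ((p : ℝ) - 1)) : ℝ) := by
  have hq := NeZero.ne q
  rw [sum_apply_mul_log_conductor, if_pos rfl, mul_sub,
    ← sum_divisors_vonMangoldt_mul_totient hq]
  simp [Nat.div_self (Nat.pos_of_ne_zero hq)]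

theorem sum_apply_mul_log_conductor_of_ne_one {q : ℕ} [NeZero q] {u : (ZMod q)ˣ} (hu : u ≠ 1) :
    ∑ χ : DirichletCharacter ℂ q, χ (u : ZMod q) * (Real.log χ.conductor : ℂ) =
      (-((q.totient : ℝ) *
        (ArithmeticFunction.vonMangoldt (q / q.gcd ((u : ZMod q) - 1).val) /
          (q / q.gcd ((u : ZMod q) - 1).val).totient)) : ℝ) := by
  have hq := NeZero.ne q
  have hg := Nat.gcd_dvd_left q ((u : ZMod q) - 1).val
  have hm : q / q.gcd ((u : ZMod q) - 1).val ≠ 1 := by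
    intro h
    have hgq : q.gcd ((u : ZMod q) - 1).val = q := by
      simpa [h] using Nat.div_mul_cancel hg
    have hdvd := Nat.gcd_eq_left_iff_dvd.mp hgq
    rw [← ZMod.natCast_eq_zero_iff, ZMod.natCast_zmod_val, sub_eq_zero] at hdvd
    exact hu (Units.ext hdvd)
  rw [sum_apply_mul_log_conductor, if_neg hu,
    sum_divisors_dvd_vonMangoldt_mul_totient hq (Nat.div_dvd_of_dvd hg) hm, zero_sub]

theorem normSq_sum_mul_apply {q k : ℕ} [NeZero q] (χ : DirichletCharacter ℂ q)
    (a : Fin k → (ZMod q)ˣ) (α : Fin k → ℝ) :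
    ((‖∑ i, (α i : ℂ) * χ (a i : ZMod q)‖ ^ 2 : ℝ) : ℂ) =
      ∑ i, ∑ j, (α i * α j : ℂ) * χ ((a i * (a j)⁻¹ : (ZMod q)ˣ) : ZMod q) := by
  have hconj : ∀ u : (ZMod q)ˣ,
      (starRingEnd ℂ) (χ (u : ZMod q)) = χ ((u⁻¹ : (ZMod q)ˣ) : ZMod q) := by
    intro u
    rw [starRingEnd_apply, MulChar.star_apply', MulChar.inv_apply, Ring.inverse_unit]
  rw [Complex.ofReal_pow, ← Complex.mul_conj', map_sum, Finset.sum_mul_sum]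
  refine Finset.sum_congr rfl fun i _ ↦ Finset.sum_congr rfl fun j _ ↦ ?_
  rw [map_mul, Complex.conj_ofReal, hconj, Units.val_mul, map_mul]
  ring

end DirichletCharacter

theorem exact_variance_expression (q : ℕ) (hq : 3 ≤ q) (k : ℕ)
    (a : Fin k → (ZMod q)ˣ) (ha : Function.Injective a) (α : Fin k → ℝ) :
    (∑ χ : DirichletCharacter ℂ q,
        ‖∑ i, (α i : ℂ) * χ ((a i : ZMod q))‖ ^ 2 *
          Real.log ((DirichletCharacter.conductor χ : ℝ))) =
      (q.totient : ℝ) * (∑ i, (α i) ^ 2) *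
          (Real.log q - ∑ p ∈ q.primeFactors, Real.log p / ((p : ℝ) - 1)) -
        (q.totient : ℝ) * ∑ i, ∑ j,
          if i = j then 0 else
            α i * α j *
              (ArithmeticFunction.vonMangoldt
                  (q / Nat.gcd q ((((a i * (a j)⁻¹ : (ZMod q)ˣ) : ZMod q) - 1).val)) /
                (Nat.totient
                  (q / Nat.gcd q ((((a i * (a j)⁻¹ : (ZMod q)ˣ) : ZMod q) - 1).val)) : ℝ)) := by
  have : NeZero q := ⟨by omega⟩
  have hsum : ∀ i j, (∑ χ : DirichletCharacter ℂ q,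
      (α i * α j : ℂ) * χ ((a i * (a j)⁻¹ : (ZMod q)ˣ) : ZMod q) *
        (Real.log χ.conductor : ℂ)) =
      (((if i = j then (q.totient : ℝ) * (α i) ^ 2 *
          (Real.log q - ∑ p ∈ q.primeFactors, Real.log p / ((p : ℝ) - 1)) else 0) -
        (q.totient : ℝ) * (if i = j then 0 else
            α i * α j *
              (ArithmeticFunction.vonMangoldt
                  (q / Nat.gcd q ((((a i * (a j)⁻¹ : (ZMod q)ˣ) : ZMod q) - 1).val)) /
                (Nat.totient
                  (q / Nat.gcd q ((((a i * (a j)⁻¹ : (ZMod q)ˣ) : ZMod q) - 1).val)) : ℝ))) :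
        ℝ) : ℂ) := by
    intro i j
    simp only [mul_assoc]
    rw [← Finset.mul_sum, ← Finset.mul_sum]
    by_cases hij : i = j
    · subst hij
      rw [mul_inv_cancel, DirichletCharacter.sum_apply_one_mul_log_conductor, if_pos rfl,
        if_pos rfl]
      push_cast
      ring
    · have hne : a i * (a j)⁻¹ ≠ 1 := fun h ↦ hij (ha (mul_inv_eq_one.mp h))
      rw [DirichletCharacter.sum_apply_mul_log_conductor_of_ne_one hne, if_neg hij, if_neg hij]
      push_cast
      ring
  apply Complex.ofReal_injective
  rw [Complex.ofReal_sum]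
  simp only [Complex.ofReal_mul (‖_‖ ^ 2), DirichletCharacter.normSq_sum_mul_apply,
    Finset.sum_mul]
  rw [Finset.sum_comm]
  simp only [Finset.sum_comm (s := (Finset.univ : Finset (DirichletCharacter ℂ q))), hsum]
  simp only [← Complex.ofReal_sum]
  congr 1
  simp only [Finset.sum_sub_distrib, ← Finset.mul_sum, Finset.sum_ite_eq, Finset.mem_univ,
    if_true, ← Finset.sum_mul]
end
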